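/- In the transfinite construction over a full model N: for every ordinal α, if t₁ ∼_α τ with τ ≠ ω and τ ≠ ε, and t₁ t₂ ⇝ ⊤ (for the stable relation ⇝), then there exists a canonical term ρ ∈ T_τ with t₂ ⇝ ρ. -/

import Mathlib

/-! Infrastructure: the transfinite model construction over a full model of
classical higher-order logic, following Czajka, "A semantic approach to illative
combinatory logic", Section 4. -/

namespace ILM

/-- Type-free λ-terms over a set `C` of primitive constants (de Bruijn representation). -/
inductive Tm (C : Type) : Type
  | var : Nat → Tm C
  | const : C → Tm C
  | app : Tm C → Tm C → Tm C
  | lam : Tm C → Tm C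

namespace Tm

variable {C : Type}

/-- Renaming of free de Bruijn variables. -/
def rename (f : Nat → Nat) : Tm C → Tm C
  | .var n => .var (f n)
  | .const c => .const c
  | .app a b => .app (a.rename f) (b.rename f)
  | .lam a => .lam (a.rename fun n => match n with | 0 => 0 | m + 1 => f m + 1)

/-- Shift all free variables up by one. -/
def lift (t : Tm C) : Tm C := t.rename (· + 1)

/-- Simultaneous substitution. -/
def bind (σ : Nat → Tm C) : Tm C → Tm C
  | .var n => σ n
  | .const c => .const c
  | .app a b => .app (a.bind σ) (b.bind σ)
  | .lam a => .lam (a.bind fun n => match n with | 0 => .var 0 | m + 1 => (σ m).lift)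

/-- Substitution of `s` for the variable `0` (β-contraction of `(λ.t) s`). -/
def subst0 (t s : Tm C) : Tm C := t.bind fun n => match n with | 0 => s | m + 1 => .var m

end Tm

/-- Extended types `T⁺`: the constructors generate all expressions
`o | B | arr | ω | ε`; the grammar `T⁺ ::= T₁ | ω | ε`, `T₁ ::= T | T₁→T₁ | ω→T₁`
is captured by the predicate `IsT1` below. -/
inductive ETy (B : Type) : Type
  | o : ETy B
  | base : B → ETy B
  | arr : ETy B → ETy B → ETy B
  | omega : ETy B
  | eps : ETy B
deriving DecidableEq

/-- Membership in `T₁` (so `T⁺ = T₁ ∪ {ω, ε}`). -/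
inductive IsT1 {B : Type} : ETy B → Prop
  | o : IsT1 .o
  | base (b : B) : IsT1 (.base b)
  | arr {τ1 τ2 : ETy B} : IsT1 τ1 → IsT1 τ2 → IsT1 (.arr τ1 τ2)
  | omegaArr {τ2 : ETy B} : IsT1 τ2 → IsT1 (.arr .omega τ2)

/-- Membership in `T⁺`. -/
def IsTp {B : Type} (τ : ETy B) : Prop := IsT1 τ ∨ τ = .omega ∨ τ = .eps

/-- The normalized arrow `τ₁ → τ₂`, implementing the notational conventions
`τ→ε = ε` (for `τ ≠ ε`), `ε→τ = ω` and `τ→ω = ω`. -/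
def arrN {B : Type} : ETy B → ETy B → ETy B
  | _, .omega => .omega
  | .eps, _ => .omega
  | _, .eps => .eps
  | τ1, τ2 => .arr τ1 τ2

/-- The rank of a type. -/
def rank {B : Type} : ETy B → Nat
  | .arr τ1 τ2 => max (rank τ1 + 1) (rank τ2)
  | _ => 1

/-- A canonical system over domains `D` for the base types: the primitive
constants `Σ⁺ = {Ξ, L} ∪ {A_τ : τ ∈ B} ∪ ⋃_τ Σ_τ`, the sets `T_τ` of canonical
terms of each type, the distinguished canonical constants `⊤, ⊥` of type `o`,
and the function `F` associating to each canonical term of a function type its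
set-theoretic function, as constructed in the paper from a full model
`N = ⟨{D_τ}, I⟩` of classical higher-order logic.  The fields axiomatize the
construction: the sets of canonical terms of distinct types are disjoint sets of
closed normal terms (`T_ω` is the set of all terms, `T_ε = ∅`), for `τ₁ ≠ ω`
the canonical terms of type `τ₁→τ₂` are constants corresponding bijectively
(via `F`) to *all* set-theoretic functions from `T_{τ₁}` to `T_{τ₂}` (this is
where fullness of `N` enters), the canonical terms of type `ω→τ₂` are the terms
`λx.ρ` with `ρ ∈ T_{τ₂}` (with `F` giving constant functions), the canonical
terms of base type `b` correspond bijectively to the domain `D b`, and those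
of type `o` are exactly `⊤` and `⊥`. -/
structure CanSys (B : Type) (D : B → Type) where
  /-- the primitive constants `Σ⁺` -/
  C : Type
  cXi : C
  cL : C
  cA : B → C
  /-- the sets `T_τ` of canonical terms -/
  TT : ETy B → Set (Tm C)
  /-- the canonical constant `⊤ ∈ Σ_o` -/
  top : Tm C
  /-- the canonical constant `⊥ ∈ Σ_o` -/
  bot : Tm C
  /-- `F τ₁ τ₂ ρ t` : the value at `t ∈ T_{τ₁}` of the function associated with
  the canonical term `ρ ∈ T_{τ₁→τ₂}` -/
  F : ETy B → ETy B → Tm C → Tm C → Tm C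
  hXiL : cXi ≠ cL
  hXiA : ∀ b, cXi ≠ cA b
  hLA : ∀ b, cL ≠ cA b
  hAinj : Function.Injective cA
  TT_omega : TT .omega = Set.univ
  TT_eps : TT .eps = ∅
  TT_invalid : ∀ τ : ETy B, ¬ IsT1 τ → τ ≠ .omega → TT τ = ∅
  TT_o : TT .o = {top, bot}
  top_ne_bot : top ≠ bot
  TT_const : ∀ τ : ETy B, IsT1 τ → (∀ τ2, τ ≠ .arr .omega τ2) →
    ∀ t ∈ TT τ, ∃ c : C, t = .const c
  TT_base_equiv : ∀ b : B, Nonempty (D b ≃ TT (.base b))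
  TT_omega_arr : ∀ τ2 : ETy B, IsT1 τ2 → TT (.arr .omega τ2) = Tm.lam '' TT τ2
  F_omega : ∀ τ2 : ETy B, ∀ ρ ∈ TT τ2, ∀ t : Tm C, F .omega τ2 (.lam ρ) t = ρ
  F_mapsto : ∀ τ1 τ2 : ETy B, IsT1 (.arr τ1 τ2) →
    ∀ ρ ∈ TT (.arr τ1 τ2), ∀ t ∈ TT τ1, F τ1 τ2 ρ t ∈ TT τ2
  F_full : ∀ τ1 τ2 : ETy B, IsT1 (.arr τ1 τ2) → τ1 ≠ .omega →
    ∀ g : Tm C → Tm C, (∀ t ∈ TT τ1, g t ∈ TT τ2) →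
      ∃ ρ ∈ TT (.arr τ1 τ2), ∀ t ∈ TT τ1, F τ1 τ2 ρ t = g t
  F_inj : ∀ τ1 τ2 : ETy B, IsT1 (.arr τ1 τ2) → τ1 ≠ .omega →
    ∀ ρ ∈ TT (.arr τ1 τ2), ∀ ρ' ∈ TT (.arr τ1 τ2),
      (∀ t ∈ TT τ1, F τ1 τ2 ρ t = F τ1 τ2 ρ' t) → ρ = ρ'
  TT_disj : ∀ τ τ' : ETy B, τ ≠ τ' → τ ≠ .omega → τ' ≠ .omega →
    Disjoint (TT τ) (TT τ')
  prim_notin : ∀ τ : ETy B, τ ≠ .omega →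
    Tm.const cXi ∉ TT τ ∧ Tm.const cL ∉ TT τ ∧ ∀ b, Tm.const (cA b) ∉ TT τ
  cover : ∀ c : C, c = cXi ∨ c = cL ∨ (∃ b, c = cA b) ∨
    ∃ τ : ETy B, τ ≠ .omega ∧ Tm.const c ∈ TT τ

namespace CanSys

variable {B : Type} {D : B → Type} (S : CanSys B D)

/-- The term `Ξ`. -/
def XiT : Tm S.C := .const S.cXi

/-- The term `L`. -/
def LT : Tm S.C := .const S.cL

/-- The term `A_b`. -/
def AT (b : B) : Tm S.C := .const (S.cA b)

/-- `K t = λx.t` with `x ∉ FV(t)`. -/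
def Kt (t : Tm S.C) : Tm S.C := .lam t.lift

/-- `H t = L (K t)`. -/
def Ht (t : Tm S.C) : Tm S.C := .app S.LT (S.Kt t)

/-- The term `H = λx. L (K x)`. -/
def Hterm : Tm S.C := .lam (.app S.LT (.lam (.var 1)))

/-- `F t₁ t₂`, written out according to the notational convention:
`λf. Ξ t₁ (λx. t₂ (f x))` if `t₂` is not a λ-abstraction, and
`λf. Ξ t₁ (λx. q₂[z/(f x)])` if `t₂ = λz. q₂`. -/
def Ft (t1 t2 : Tm S.C) : Tm S.C :=
  .lam (.app (.app S.XiT t1.lift)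
    (match t2 with
     | .lam b => .lam (b.bind fun n => match n with
         | 0 => .app (.var 1) (.var 0)
         | m + 1 => .var (m + 2))
     | t2 => .lam (.app t2.lift.lift (.app (.var 1) (.var 0)))))

end CanSys


mutual
  /-- One-step reduction `→_{≤α}` of the reduction system `R_α`: the context
  closure of β- and η-reduction together with the rules `c t → F(c)(ρ₁)` for
  canonical constants `c ∈ Σ_{τ₁→τ₂}` (`τ₁ ≠ ω`) and `t ≻_{<α} ρ₁`. -/
  inductive Step {B : Type} {D : B → Type} (S : CanSys B D) :
      Ordinal.{0} → Tm S.C → Tm S.C → Prop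
    | beta (α : Ordinal.{0}) (t s : Tm S.C) : Step S α (.app (.lam t) s) (t.subst0 s)
    | eta (α : Ordinal.{0}) (t : Tm S.C) : Step S α (.lam (.app t.lift (.var 0))) t
    | crule {α γ : Ordinal.{0}} (hγ : γ < α) {τ1 τ2 : ETy B} (h1 : τ1 ≠ .omega)
        {c : Tm S.C} (hc : c ∈ S.TT (.arr τ1 τ2)) {ρ1 : Tm S.C} (hρ1 : ρ1 ∈ S.TT τ1)
        {t : Tm S.C} (hs : Succ S γ t ρ1) :
        Step S α (.app c t) (S.F τ1 τ2 c ρ1)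
    | appL {α : Ordinal.{0}} {t t' : Tm S.C} (s : Tm S.C) :
        Step S α t t' → Step S α (.app t s) (.app t' s)
    | appR (t : Tm S.C) {α : Ordinal.{0}} {s s' : Tm S.C} :
        Step S α s s' → Step S α (.app t s) (.app t s')
    | lam {α : Ordinal.{0}} {t t' : Tm S.C} :
        Step S α t t' → Step S α (.lam t) (.lam t')

  /-- Many-step reduction `↠_{≤α}` (the reflexive-transitive closure of `→_{≤α}`). -/
  inductive Steps {B : Type} {D : B → Type} (S : CanSys B D) :
      Ordinal.{0} → Tm S.C → Tm S.C → Prop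
    | refl (α : Ordinal.{0}) (t : Tm S.C) : Steps S α t t
    | tail {α : Ordinal.{0}} {t u v : Tm S.C} :
        Steps S α t u → Step S α u v → Steps S α t v

  /-- `t ⇝_α ρ` : `t ↠_{≤α} t' ≻_α ρ` for some `t'`. -/
  inductive Lead {B : Type} {D : B → Type} (S : CanSys B D) :
      Ordinal.{0} → Tm S.C → Tm S.C → Prop
    | mk {α : Ordinal.{0}} {t t' ρ : Tm S.C} :
        Steps S α t t' → Succ S α t' ρ → Lead S α t ρ

  /-- `t ⇝_{<α} ρ` : `t ⇝_γ ρ` for some `γ < α`. -/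
  inductive LeadLt {B : Type} {D : B → Type} (S : CanSys B D) :
      Ordinal.{0} → Tm S.C → Tm S.C → Prop
    | mk {α γ : Ordinal.{0}} {t ρ : Tm S.C} :
        γ < α → Lead S γ t ρ → LeadLt S α t ρ

  /-- The typing relation `t ∼_α τ` (Definition 4.4), by the rules
  (A), (H), (Kω), (Kε), (F) and (Fω). -/
  inductive Sim {B : Type} {D : B → Type} (S : CanSys B D) :
      Ordinal.{0} → Tm S.C → ETy B → Prop
    | ofA (α : Ordinal.{0}) (b : B) : Sim S α (S.AT b) (.base b)
    | ofH (α : Ordinal.{0}) : Sim S α S.Hterm .o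
    | ofKom {α : Ordinal.{0}} {t : Tm S.C} :
        LeadLt S α t S.top → Sim S α (S.Kt t) .omega
    | ofKeps {α : Ordinal.{0}} {t : Tm S.C} :
        LeadLt S α t S.bot → Sim S α (S.Kt t) .eps
    | ofF {α γ1 γ2 : Ordinal.{0}} (h1 : γ1 < α) (h2 : γ2 < α)
        {t1 t2 : Tm S.C} {τ1 τ2 : ETy B} :
        Sim S γ1 t1 τ1 → Sim S γ2 t2 τ2 → Sim S α (S.Ft t1 t2) (arrN τ1 τ2)
    | ofFom {α γ : Ordinal.{0}} (hγ : γ < α) {t1 t2 : Tm S.C} :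
        Sim S γ t1 .eps → Sim S α (S.Ft t1 t2) .omega

  /-- The relation `t ≻_α ρ` between terms and canonical terms (Definition 4.5). -/
  inductive Succ {B : Type} {D : B → Type} (S : CanSys B D) :
      Ordinal.{0} → Tm S.C → Tm S.C → Prop
    /- `ρ ≻_α ρ` for canonical `ρ` -/
    | refl {τ : ETy B} (hτ : τ ≠ .omega) {ρ : Tm S.C} (hρ : ρ ∈ S.TT τ)
        (α : Ordinal.{0}) : Succ S α ρ ρ
    /- `t ≻_α ρ` when `ρ` has canonical type `τ₁→τ₂` (possibly `τ₁ = ω`) and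
       `t t₁ ⇝_{<α} F(ρ)(t₁)` for all `t₁ ∈ T_{τ₁}` -/
    | fn {τ1 τ2 : ETy B} {ρ : Tm S.C} (hρ : ρ ∈ S.TT (.arr τ1 τ2))
        {α : Ordinal.{0}} {t : Tm S.C}
        (h : ∀ t1 ∈ S.TT τ1, LeadLt S α (.app t t1) (S.F τ1 τ2 ρ t1)) :
        Succ S α t ρ
    /- base postulates for `t ≻_α ⊤` -/
    | topLA (α : Ordinal.{0}) (b : B) : Succ S α (.app S.LT (S.AT b)) S.top
    | topLH (α : Ordinal.{0}) : Succ S α (.app S.LT S.Hterm) S.top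
    | topA {b : B} {c : Tm S.C} (hc : c ∈ S.TT (.base b)) (α : Ordinal.{0}) :
        Succ S α (.app (S.AT b) c) S.top
    | topH {c : Tm S.C} (hc : c = S.top ∨ c = S.bot) (α : Ordinal.{0}) :
        Succ S α (S.Ht c) S.top
    /- `(Ξ_i^⊤)` -/
    | xiTop {α : Ordinal.{0}} (hα : 0 < α) {t1 t2 : Tm S.C} {τ : ETy B}
        (h1 : Sim S α t1 τ) (h2 : ∀ t3 ∈ S.TT τ, LeadLt S α (.app t2 t3) S.top) :
        Succ S α (.app (.app S.XiT t1) t2) S.top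
    /- `(Ξ_H^⊤)` -/
    | xiHTop {α : Ordinal.{0}} (hα : 0 < α) {t1 t2 : Tm S.C} {τ : ETy B}
        (h1 : Sim S α t1 τ)
        (h2 : ∀ t3 ∈ S.TT τ, LeadLt S α (S.Ht (.app t2 t3)) S.top) :
        Succ S α (S.Ht (.app (.app S.XiT t1) t2)) S.top
    /- `(F_L^⊤)`, first case: `t₁ ∼_α ε` -/
    | flTopEps {α : Ordinal.{0}} (hα : 0 < α) {t1 t2 : Tm S.C}
        (h1 : Sim S α t1 .eps) :
        Succ S α (.app S.LT (S.Ft t1 t2)) S.top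
    /- `(F_L^⊤)`, second case: `t₁ ∼_α τ` for some `τ ≠ ε` and `L t₂ ⇝_{<α} ⊤` -/
    | flTop {α : Ordinal.{0}} (hα : 0 < α) {t1 t2 : Tm S.C} {τ : ETy B}
        (hτ : τ ≠ .eps) (h1 : Sim S α t1 τ) (h2 : LeadLt S α (.app S.LT t2) S.top) :
        Succ S α (.app S.LT (S.Ft t1 t2)) S.top
    /- `(H_i^⊤)` -/
    | hiTop {α : Ordinal.{0}} (hα : 0 < α) {t1 : Tm S.C} (h : LeadLt S α t1 S.top) :
        Succ S α (S.Ht t1) S.top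
    /- `(Ξ^⊥)` -/
    | xiBot {α : Ordinal.{0}} (hα : 0 < α) {t1 t2 : Tm S.C} {τ : ETy B}
        {γ : Ordinal.{0}} (hγ : γ < α)
        (hH : Succ S γ (S.Ht (.app (.app S.XiT t1) t2)) S.top)
        (h1 : Sim S α t1 τ) {t3 : Tm S.C} (h3 : t3 ∈ S.TT τ)
        (hb : LeadLt S α (.app t2 t3) S.bot) :
        Succ S α (.app (.app S.XiT t1) t2) S.bot
end


variable {B : Type} {D : B → Type}

/-- `t ≻ ρ` : the stable relation `≻_ζ` at the closure ordinal (by monotonicity,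
it equals the union of the `≻_α` over all ordinals `α`). -/
def SuccS (S : CanSys B D) (t ρ : Tm S.C) : Prop := ∃ α : Ordinal.{0}, Succ S α t ρ

/-- `t ∼ τ` : the stable typing relation. -/
def SimS (S : CanSys B D) (t : Tm S.C) (τ : ETy B) : Prop := ∃ α : Ordinal.{0}, Sim S α t τ

/-- One-step reduction of the stable reduction system `R`. -/
def StepR (S : CanSys B D) (t t' : Tm S.C) : Prop := ∃ α : Ordinal.{0}, Step S α t t'

/-- `t ↠_R t'` : many-step reduction in the stable reduction system `R`. -/
def StepsR (S : CanSys B D) : Tm S.C → Tm S.C → Prop := Relation.ReflTransGen (StepR S)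

/-- `t ⇝ ρ` : the stable relation `⇝_ζ`. -/
def LeadR (S : CanSys B D) (t ρ : Tm S.C) : Prop :=
  ∃ t', StepsR S t t' ∧ SuccS S t' ρ

/-- `t =_{≤α} t'` : convertibility in `R_α`. -/
def ConvLe (S : CanSys B D) (α : Ordinal.{0}) : Tm S.C → Tm S.C → Prop :=
  Relation.EqvGen (Step S α)

/-- `t =_R t'` : convertibility in the stable reduction system `R`. -/
def ConvR (S : CanSys B D) : Tm S.C → Tm S.C → Prop :=
  Relation.EqvGen (StepR S)

/-- Filling the boxes `□₁, …, □ₖ` of a `k`-ary context (a λ-term over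
`Σ⁺ ∪ {□₁, …, □ₖ}`) with terms, in such a way that the free variables of the
inserted terms do not become bound. -/
def fillk {C : Type} {k : Nat} (ts : Fin k → Tm C) : Tm (Fin k ⊕ C) → Tm C
  | .var n => .var n
  | .const (.inl i) => ts i
  | .const (.inr c) => .const c
  | .app a b => .app (fillk ts a) (fillk ts b)
  | .lam a => .lam (fillk (fun i => (ts i).lift) a)

/-- Filling a unary context. -/
def fill1 {C : Type} (Ctx : Tm (Fin 1 ⊕ C)) (t : Tm C) : Tm C :=
  fillk (fun _ => t) Ctx

/-- `t ≫^n t'` (at the stable level): there are a `k`-ary context `Cx`, terms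
`t₁, …, t_k` and canonical terms `ρ₁, …, ρ_k` of ranks `≤ n` with `tᵢ ≻ ρᵢ`,
`t = Cx[t₁,…,t_k]` and `t' = Cx[ρ₁,…,ρ_k]`. -/
def Gg (S : CanSys B D) (n : Nat) (t t' : Tm S.C) : Prop :=
  ∃ (k : Nat) (Cx : Tm (Fin k ⊕ S.C)) (ts ρs : Fin k → Tm S.C),
    (∀ i, SuccS S (ts i) (ρs i)) ∧
    (∀ i, ∃ τ : ETy B, τ ≠ .omega ∧ ρs i ∈ S.TT τ ∧ rank τ ≤ n) ∧
    t = fillk ts Cx ∧ t' = fillk ρs Cx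

namespace Tm

variable {C : Type}

/-- The substitution `σ` pushed under a binder. -/
def up (σ : Nat → Tm C) : Nat → Tm C := fun n => match n with
  | 0 => .var 0
  | m + 1 => (σ m).lift

/-- The substitution sending `0` to `s` and `m + 1` to `σ m`. -/
def scons (s : Tm C) (σ : Nat → Tm C) : Nat → Tm C := fun n => match n with
  | 0 => s
  | m + 1 => σ m

/-- `n` occurs free in a term. -/
def Occ : Nat → Tm C → Prop
  | n, .var m => n = m
  | _, .const _ => False
  | n, .app a b => Occ n a ∨ Occ n b
  | n, .lam a => Occ (n + 1) a

/-- The number of constructors of a term. -/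
def size : Tm C → Nat
  | .var _ => 1
  | .const _ => 1
  | .app a b => a.size + b.size + 1
  | .lam a => a.size + 1

@[simp] theorem bind_lam (a : Tm C) (σ : Nat → Tm C) :
    (Tm.lam a).bind σ = .lam (a.bind (up σ)) := rfl

@[simp] theorem bind_app (a b : Tm C) (σ : Nat → Tm C) :
    (Tm.app a b).bind σ = .app (a.bind σ) (b.bind σ) := rfl

@[simp] theorem bind_const (c : C) (σ : Nat → Tm C) : (Tm.const c).bind σ = .const c := rfl

@[simp] theorem bind_var_apply (n : Nat) (σ : Nat → Tm C) : (Tm.var n).bind σ = σ n := rfl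

@[simp] theorem up_zero (σ : Nat → Tm C) : up σ 0 = .var 0 := rfl

@[simp] theorem up_succ (σ : Nat → Tm C) (m : Nat) : up σ (m + 1) = (σ m).lift := rfl

@[simp] theorem scons_zero (s : Tm C) (σ : Nat → Tm C) : scons s σ 0 = s := rfl

@[simp] theorem scons_succ (s : Tm C) (σ : Nat → Tm C) (m : Nat) :
    scons s σ (m + 1) = σ m := rfl

theorem subst0_eq (t s : Tm C) : t.subst0 s = t.bind (scons s .var) := rfl

theorem rename_eq_bind (t : Tm C) (f : Nat → Nat) :
    t.rename f = t.bind fun n => .var (f n) := by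
  induction t generalizing f with
  | var n => rfl
  | const c => rfl
  | app a b iha ihb => simp [rename, iha, ihb]
  | lam a ih =>
    simp only [rename, bind_lam, ih]
    congr 2
    funext n
    cases n <;> rfl

theorem lift_eq_bind (t : Tm C) : t.lift = t.bind fun n => .var (n + 1) :=
  rename_eq_bind t _

theorem bind_congr {t : Tm C} {σ σ' : Nat → Tm C} (h : ∀ n, Occ n t → σ n = σ' n) :
    t.bind σ = t.bind σ' := by
  induction t generalizing σ σ' with
  | var n => exact h n rfl
  | const c => rfl
  | app a b iha ihb =>
    simp [iha fun n hn => h n (Or.inl hn), ihb fun n hn => h n (Or.inr hn)]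
  | lam a ih =>
    simp only [bind_lam]
    congr 1
    refine ih fun n hn => ?_
    cases n with
    | zero => rfl
    | succ m => simp [h m hn]

theorem up_var : up (Tm.var : Nat → Tm C) = .var := by
  funext n
  cases n <;> rfl

@[simp] theorem bind_var (t : Tm C) : t.bind .var = t := by
  induction t with
  | var n => rfl
  | const c => rfl
  | app a b iha ihb => simp [iha, ihb]
  | lam a ih => simp [up_var, ih]

theorem rename_bind (t : Tm C) (f : Nat → Nat) (σ : Nat → Tm C) :
    (t.rename f).bind σ = t.bind fun n => σ (f n) := by
  induction t generalizing f σ with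
  | var n => rfl
  | const c => rfl
  | app a b iha ihb => simp [rename, iha, ihb]
  | lam a ih =>
    simp only [rename, bind_lam, ih]
    congr 2
    funext n
    cases n <;> rfl

theorem rename_rename (t : Tm C) (f g : Nat → Nat) :
    (t.rename f).rename g = t.rename fun n => g (f n) := by
  rw [rename_eq_bind (t.rename f), rename_bind, rename_eq_bind t]

theorem lift_bind (t : Tm C) (σ : Nat → Tm C) :
    t.lift.bind σ = t.bind fun n => σ (n + 1) :=
  rename_bind t _ σ

theorem bind_rename (t : Tm C) (σ : Nat → Tm C) (f : Nat → Nat) :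
    (t.bind σ).rename f = t.bind fun n => (σ n).rename f := by
  induction t generalizing σ f with
  | var n => rfl
  | const c => rfl
  | app a b iha ihb => simp [rename, iha, ihb]
  | lam a ih =>
    simp only [rename, bind_lam, ih]
    congr 2
    funext n
    cases n with
    | zero => rfl
    | succ m => simp [lift, rename_rename]

theorem lift_bind_up (t : Tm C) (σ : Nat → Tm C) : t.lift.bind (up σ) = (t.bind σ).lift := by
  rw [lift_bind, lift, bind_rename]
  rfl

theorem bind_bind (t : Tm C) (σ σ' : Nat → Tm C) :
    (t.bind σ).bind σ' = t.bind fun n => (σ n).bind σ' := by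
  induction t generalizing σ σ' with
  | var n => rfl
  | const c => rfl
  | app a b iha ihb => simp [iha, ihb]
  | lam a ih =>
    simp only [bind_lam, ih]
    congr 2
    funext n
    cases n with
    | zero => rfl
    | succ m => simp [lift_bind_up]

@[simp] theorem lift_subst0 (t s : Tm C) : t.lift.subst0 s = t := by
  rw [subst0_eq, lift_bind]
  exact bind_var t

theorem subst0_bind (t s : Tm C) (σ : Nat → Tm C) :
    (t.subst0 s).bind σ = (t.bind (up σ)).subst0 (s.bind σ) := by
  rw [subst0_eq, subst0_eq, bind_bind, bind_bind]
  congr 1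
  funext n
  cases n with
  | zero => rfl
  | succ m =>
    have := lift_subst0 (σ m) (s.bind σ)
    rw [subst0_eq] at this
    simp [this]

theorem lift_injective : Function.Injective (lift : Tm C → Tm C) := by
  intro t s h
  simpa using congrArg (fun u => u.subst0 (.var 0)) h

theorem occ_rename {t : Tm C} {f : Nat → Nat} {n : Nat} :
    Occ n (t.rename f) ↔ ∃ m, Occ m t ∧ n = f m := by
  induction t generalizing f n with
  | var k => simp [rename, Occ]
  | const c => simp [rename, Occ]
  | app a b iha ihb =>
    simp only [rename, Occ, iha, ihb]
    constructor
    · rintro (⟨m, h, e⟩ | ⟨m, h, e⟩)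
      exacts [⟨m, .inl h, e⟩, ⟨m, .inr h, e⟩]
    · rintro ⟨m, h | h, e⟩
      exacts [.inl ⟨m, h, e⟩, .inr ⟨m, h, e⟩]
  | lam a ih =>
    simp only [rename, Occ, ih]
    constructor
    · rintro ⟨m, h, e⟩
      cases m with
      | zero => simp at e
      | succ k => exact ⟨k, h, by simpa using e⟩
    · rintro ⟨m, h, e⟩
      exact ⟨m + 1, h, by simp [e]⟩

theorem occ_lift {t : Tm C} {n : Nat} : Occ n t.lift ↔ ∃ m, Occ m t ∧ n = m + 1 :=
  occ_rename

theorem not_occ_zero_lift (t : Tm C) : ¬ Occ 0 t.lift := by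
  rw [occ_lift]
  rintro ⟨m, -, e⟩
  exact absurd e (by simp)

theorem occ_bind {t : Tm C} {σ : Nat → Tm C} {n : Nat} :
    Occ n (t.bind σ) ↔ ∃ m, Occ m t ∧ Occ n (σ m) := by
  induction t generalizing σ n with
  | var k => simp [Occ]
  | const c => simp [Occ]
  | app a b iha ihb =>
    simp only [bind_app, Occ, iha, ihb]
    constructor
    · rintro (⟨m, h, e⟩ | ⟨m, h, e⟩)
      exacts [⟨m, .inl h, e⟩, ⟨m, .inr h, e⟩]
    · rintro ⟨m, h | h, e⟩
      exacts [.inl ⟨m, h, e⟩, .inr ⟨m, h, e⟩]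
  | lam a ih =>
    simp only [bind_lam, Occ, ih]
    constructor
    · rintro ⟨m, h, e⟩
      cases m with
      | zero => simp [Occ] at e
      | succ k =>
        rw [up_succ, occ_lift] at e
        obtain ⟨j, hj, e⟩ := e
        exact ⟨k, h, by rwa [Nat.succ.inj e]⟩
    · rintro ⟨m, h, e⟩
      exact ⟨m + 1, h, by rw [up_succ, occ_lift]; exact ⟨n, e, rfl⟩⟩

theorem occ_subst0 {t s : Tm C} {n : Nat} (h : Occ n (t.subst0 s)) : Occ (n + 1) t ∨ Occ n s := by
  rw [subst0_eq, occ_bind] at h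
  obtain ⟨m, hm, e⟩ := h
  cases m with
  | zero => exact .inr e
  | succ k =>
    simp only [scons_succ, Occ] at e
    exact .inl (e ▸ hm)

theorem lift_subst0_of_not_occ {t : Tm C} (h : ¬ Occ 0 t) (s : Tm C) :
    (t.subst0 s).lift = t := by
  rw [subst0_eq, lift, bind_rename]
  conv_rhs => rw [← bind_var t]
  refine bind_congr fun n hn => ?_
  cases n with
  | zero => exact absurd hn h
  | succ m => rfl

theorem exists_lift_of_not_occ {t : Tm C} (h : ¬ Occ 0 t) : ∃ s : Tm C, t = s.lift :=
  ⟨t.subst0 (.var 0), (lift_subst0_of_not_occ h _).symm⟩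

theorem bind_of_closed {t : Tm C} (h : ∀ n, ¬ Occ n t) (σ : Nat → Tm C) : t.bind σ = t := by
  conv_rhs => rw [← bind_var t]
  exact bind_congr fun n hn => absurd hn (h n)

theorem size_rename (t : Tm C) (f : Nat → Nat) : (t.rename f).size = t.size := by
  induction t generalizing f with
  | var n => rfl
  | const c => rfl
  | app a b iha ihb => simp [rename, size, iha, ihb]
  | lam a ih => simp [rename, size, ih]

@[simp] theorem size_lift (t : Tm C) : t.lift.size = t.size := size_rename t _

theorem exists_occ_bound (t : Tm C) : ∃ N, ∀ n, Occ n t → n < N := by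
  induction t with
  | var n => exact ⟨n + 1, fun m hm => by simp only [Occ] at hm; omega⟩
  | const c => exact ⟨0, fun m hm => hm.elim⟩
  | app a b iha ihb =>
    obtain ⟨N, hN⟩ := iha
    obtain ⟨M, hM⟩ := ihb
    exact ⟨N + M, fun m hm => by
      rcases hm with hm | hm
      · have := hN m hm; omega
      · have := hM m hm; omega⟩
  | lam a ih =>
    obtain ⟨N, hN⟩ := ih
    exact ⟨N, fun m hm => by have := hN (m + 1) hm; omega⟩

/-- Every term has a fresh variable, to which any substitution can be extended at will. -/
theorem exists_fresh_bind (t : Tm C) :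
    ∃ n : Nat, ∀ (s : Tm C) (σ : Nat → Tm C), ∃ σ', t.bind σ' = t.bind σ ∧ σ' n = s := by
  obtain ⟨N, hN⟩ := exists_occ_bound t
  refine ⟨N, fun s σ => ⟨fun m => if m = N then s else σ m, bind_congr fun m hm => ?_, by simp⟩⟩
  have := hN m hm
  simp [this.ne]

theorem lift_eq_app {t a b : Tm C} (h : t.lift = .app a b) :
    ∃ a' b', t = .app a' b' ∧ a = a'.lift ∧ b = b'.lift := by
  cases t <;> simp_all [lift, rename]

theorem lift_eq_const {t : Tm C} {c : C} (h : t.lift = .const c) : t = .const c := by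
  cases t <;> simp_all [lift, rename]

theorem lift_eq_lam {t a : Tm C} (h : t.lift = .lam a) :
    ∃ a', t = .lam a' ∧ a = a'.bind (up fun n => .var (n + 1)) := by
  cases t with
  | lam b =>
    rw [lift_eq_bind, bind_lam] at h
    exact ⟨b, rfl, (Tm.lam.inj h).symm⟩
  | _ => simp [lift, rename] at h

theorem bind_up_succ_subst0_zero (t : Tm C) :
    (t.bind (up fun n => .var (n + 1))).subst0 (.var 0) = t := by
  rw [subst0_eq, bind_bind]
  conv_rhs => rw [← bind_var t]
  congr 1
  funext n
  cases n <;> rfl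

end Tm

theorem IsT1.arr_left {τ1 τ2 : ETy B} (h : IsT1 (.arr τ1 τ2)) : τ1 = .omega ∨ IsT1 τ1 := by
  cases h with
  | arr h _ => exact .inr h
  | omegaArr _ => exact .inl rfl

theorem IsT1.arr_right {τ1 τ2 : ETy B} (h : IsT1 (.arr τ1 τ2)) : IsT1 τ2 := by
  cases h <;> assumption

theorem IsT1.ne_omega {τ : ETy B} (h : IsT1 τ) : τ ≠ .omega := by
  rintro rfl
  cases h

theorem arrN_cases (τ1 τ2 : ETy B) :
    arrN τ1 τ2 = .omega ∨ arrN τ1 τ2 = .eps ∨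
      (arrN τ1 τ2 = .arr τ1 τ2 ∧ τ1 ≠ .eps ∧ τ2 ≠ .omega ∧ τ2 ≠ .eps) := by
  cases τ2 <;> cases τ1 <;> simp [arrN]

@[simp] theorem arrN_omega (τ1 : ETy B) : arrN τ1 .omega = .omega := by
  cases τ1 <;> rfl

@[simp] theorem arrN_eps_left (τ2 : ETy B) : arrN .eps τ2 = .omega := by
  cases τ2 <;> rfl

theorem arrN_eps_right {τ1 : ETy B} (h : τ1 ≠ .eps) : arrN τ1 .eps = .eps := by
  cases τ1 <;> simp_all [arrN]

theorem IsTp.arrN {τ1 τ2 : ETy B} (h1 : IsTp τ1) (h2 : IsTp τ2) : IsTp (arrN τ1 τ2) := by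
  rcases arrN_cases τ1 τ2 with h | h | ⟨h, h3, h4, h5⟩
  · exact .inr (.inl h)
  · exact .inr (.inr h)
  · rw [h]
    rcases h2 with h2 | h2 | h2
    · rcases h1 with h1 | rfl | h1
      · exact .inl (.arr h1 h2)
      · exact .inl (.omegaArr h2)
      · exact absurd h1 h3
    · exact absurd h2 h4
    · exact absurd h2 h5

namespace CanSys

variable (S : CanSys B D)

/-- Canonical terms. -/
def Canon (ρ : Tm S.C) : Prop := ∃ τ : ETy B, τ ≠ .omega ∧ ρ ∈ S.TT τ

variable {S}

theorem isT1_of_mem {τ : ETy B} {ρ : Tm S.C} (hτ : τ ≠ .omega) (h : ρ ∈ S.TT τ) : IsT1 τ := by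
  by_contra hn
  rw [S.TT_invalid τ hn hτ] at h
  exact h

theorem type_unique {τ τ' : ETy B} {ρ : Tm S.C} (hτ : τ ≠ .omega) (hτ' : τ' ≠ .omega)
    (h : ρ ∈ S.TT τ) (h' : ρ ∈ S.TT τ') : τ = τ' := by
  by_contra hn
  exact Set.disjoint_left.1 (S.TT_disj τ τ' hn hτ hτ') h h'

theorem mem_cases {τ : ETy B} {ρ : Tm S.C} (hτ : τ ≠ .omega) (h : ρ ∈ S.TT τ) :
    (∃ c, ρ = .const c) ∨
      ∃ τ2 ρ0, τ = .arr .omega τ2 ∧ IsT1 τ2 ∧ ρ0 ∈ S.TT τ2 ∧ ρ = .lam ρ0 := by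
  have h1 := isT1_of_mem hτ h
  by_cases ho : ∃ τ2, τ = .arr .omega τ2
  · obtain ⟨τ2, rfl⟩ := ho
    rw [S.TT_omega_arr τ2 h1.arr_right] at h
    obtain ⟨ρ0, h0, rfl⟩ := h
    exact .inr ⟨τ2, ρ0, rfl, h1.arr_right, h0, rfl⟩
  · push Not at ho
    exact .inl (S.TT_const τ h1 ho ρ h)

theorem const_of_mem_arr {τ1 τ2 : ETy B} {ρ : Tm S.C} (hτ : τ1 ≠ .omega)
    (h : ρ ∈ S.TT (.arr τ1 τ2)) : ∃ c, ρ = .const c := by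
  rcases mem_cases (by simp) h with hc | ⟨τ2, ρ0, e, -⟩
  · exact hc
  · simp only [ETy.arr.injEq] at e
    exact absurd e.1 hτ

theorem closed_of_mem {τ : ETy B} {ρ : Tm S.C} (hτ : τ ≠ .omega) (h : ρ ∈ S.TT τ) (n : Nat) :
    ¬ ρ.Occ n := by
  induction τ generalizing ρ n with
  | arr τ1 τ2 _ ih2 =>
    rcases mem_cases hτ h with ⟨c, rfl⟩ | ⟨τ2', ρ0, e, h1, h0, rfl⟩
    · exact id
    · simp only [ETy.arr.injEq] at e
      obtain ⟨-, rfl⟩ := e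
      exact ih2 h1.ne_omega h0 (n + 1)
  | _ =>
    rcases mem_cases hτ h with ⟨c, rfl⟩ | ⟨τ2, ρ0, e, -⟩
    · exact id
    · cases e

theorem canon_ne_app {ρ a b : Tm S.C} (h : S.Canon ρ) : ρ ≠ .app a b := by
  obtain ⟨τ, hτ, h⟩ := h
  rcases mem_cases hτ h with ⟨c, rfl⟩ | ⟨τ2, ρ0, -, -, -, rfl⟩ <;> simp

theorem canon_ne_var {ρ : Tm S.C} {n : Nat} (h : S.Canon ρ) : ρ ≠ .var n := by
  obtain ⟨τ, hτ, h⟩ := h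
  rcases mem_cases hτ h with ⟨c, rfl⟩ | ⟨τ2, ρ0, -, -, -, rfl⟩ <;> simp

theorem not_canon_Xi : ¬ S.Canon S.XiT := fun ⟨τ, hτ, h⟩ => (S.prim_notin τ hτ).1 h

theorem not_canon_L : ¬ S.Canon S.LT := fun ⟨τ, hτ, h⟩ => (S.prim_notin τ hτ).2.1 h

theorem not_canon_A (b : B) : ¬ S.Canon (S.AT b) := fun ⟨τ, hτ, h⟩ => (S.prim_notin τ hτ).2.2 b h

theorem top_mem : S.top ∈ S.TT .o := by simp [S.TT_o]

theorem bot_mem : S.bot ∈ S.TT .o := by simp [S.TT_o]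

theorem nonempty_TT (hD : ∀ b, Nonempty (D b)) {τ : ETy B} (h : IsT1 τ) :
    (S.TT τ).Nonempty := by
  induction h with
  | o => exact ⟨_, top_mem⟩
  | base b =>
    obtain ⟨e⟩ := S.TT_base_equiv b
    obtain ⟨d⟩ := hD b
    exact ⟨_, (e d).2⟩
  | @arr τ1 τ2 h1 h2 _ ih2 =>
    obtain ⟨ρ, hρ⟩ := ih2
    obtain ⟨ρ', h', -⟩ := S.F_full τ1 τ2 (.arr h1 h2) h1.ne_omega (fun _ => ρ) fun _ _ => hρ
    exact ⟨ρ', h'⟩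
  | @omegaArr τ2 h2 ih2 =>
    obtain ⟨ρ, hρ⟩ := ih2
    exact ⟨_, by rw [S.TT_omega_arr τ2 h2]; exact ⟨ρ, hρ, rfl⟩⟩

theorem nonempty_of_isTp (hD : ∀ b, Nonempty (D b)) {τ : ETy B} (h : IsTp τ)
    (hε : τ ≠ .eps) : (S.TT τ).Nonempty := by
  rcases h with h | rfl | h
  · exact nonempty_TT hD h
  · rw [S.TT_omega]
    exact ⟨S.top, trivial⟩
  · exact absurd h hε

theorem nonempty_dom (hD : ∀ b, Nonempty (D b)) {τ1 τ2 : ETy B} {ρ : Tm S.C}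
    (h : ρ ∈ S.TT (.arr τ1 τ2)) : (S.TT τ1).Nonempty := by
  rcases (isT1_of_mem (by simp) h).arr_left with rfl | h1
  · rw [S.TT_omega]
    exact ⟨S.top, trivial⟩
  · exact nonempty_TT hD h1

theorem F_mem {τ1 τ2 : ETy B} {ρ t : Tm S.C} (h : ρ ∈ S.TT (.arr τ1 τ2)) (ht : t ∈ S.TT τ1) :
    S.F τ1 τ2 ρ t ∈ S.TT τ2 :=
  S.F_mapsto τ1 τ2 (isT1_of_mem (by simp) h) ρ h t ht

theorem cod_ne_omega {τ1 τ2 : ETy B} {ρ : Tm S.C} (h : ρ ∈ S.TT (.arr τ1 τ2)) : τ2 ≠ .omega :=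
  (isT1_of_mem (by simp) h).arr_right.ne_omega

theorem arr_ext {τ1 τ2 : ETy B} {ρ ρ' : Tm S.C} (h : ρ ∈ S.TT (.arr τ1 τ2))
    (h' : ρ' ∈ S.TT (.arr τ1 τ2)) (he : ∀ t ∈ S.TT τ1, S.F τ1 τ2 ρ t = S.F τ1 τ2 ρ' t) :
    ρ = ρ' := by
  have h1 := isT1_of_mem (by simp) h
  by_cases ho : τ1 = .omega
  · subst ho
    rw [S.TT_omega_arr τ2 h1.arr_right] at h h'
    obtain ⟨ρ0, h0, rfl⟩ := h
    obtain ⟨ρ0', h0', rfl⟩ := h'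
    have := he S.top (by rw [S.TT_omega]; trivial)
    rw [S.F_omega τ2 ρ0 h0, S.F_omega τ2 ρ0' h0'] at this
    rw [this]
  · exact S.F_inj τ1 τ2 h1 ho ρ h ρ' h' he

end CanSys

open CanSys

/-- One-step reduction in which the applicability of the rules `c t → F(c)(ρ)` is decided by an
arbitrary relation `P t ρ`. -/
inductive OStep (S : CanSys B D) (P : Tm S.C → Tm S.C → Prop) : Tm S.C → Tm S.C → Prop
  | beta (t s : Tm S.C) : OStep S P (.app (.lam t) s) (t.subst0 s)
  | eta (t : Tm S.C) : OStep S P (.lam (.app t.lift (.var 0))) t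
  | crule {τ1 τ2 : ETy B} (h1 : τ1 ≠ .omega) {c : Tm S.C} (hc : c ∈ S.TT (.arr τ1 τ2))
      {ρ1 : Tm S.C} (hρ1 : ρ1 ∈ S.TT τ1) {t : Tm S.C} (hs : P t ρ1) :
      OStep S P (.app c t) (S.F τ1 τ2 c ρ1)
  | appL {t t' : Tm S.C} (s : Tm S.C) : OStep S P t t' → OStep S P (.app t s) (.app t' s)
  | appR (t : Tm S.C) {s s' : Tm S.C} : OStep S P s s' → OStep S P (.app t s) (.app t s')
  | lam {t u : Tm S.C} : OStep S P t u → OStep S P (.lam t) (.lam u)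

/-- Parallel reduction with the rules `c t → F(c)(ρ)` governed by `P`. -/
inductive OPar (S : CanSys B D) (P : Tm S.C → Tm S.C → Prop) : Tm S.C → Tm S.C → Prop
  | var (n : Nat) : OPar S P (.var n) (.var n)
  | const (c : S.C) : OPar S P (.const c) (.const c)
  | app {a a' b b' : Tm S.C} : OPar S P a a' → OPar S P b b' → OPar S P (.app a b) (.app a' b')
  | lam {a a' : Tm S.C} : OPar S P a a' → OPar S P (.lam a) (.lam a')
  | beta {t t' s s' : Tm S.C} : OPar S P t t' → OPar S P s s' →
      OPar S P (.app (.lam t) s) (t'.subst0 s')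
  | eta {t t' : Tm S.C} : OPar S P t t' → OPar S P (.lam (.app t.lift (.var 0))) t'
  | crule {τ1 τ2 : ETy B} (h1 : τ1 ≠ .omega) {c : Tm S.C} (hc : c ∈ S.TT (.arr τ1 τ2))
      {ρ1 : Tm S.C} (hρ1 : ρ1 ∈ S.TT τ1) {t : Tm S.C} (hs : P t ρ1) :
      OPar S P (.app c t) (S.F τ1 τ2 c ρ1)

/-- Relations between terms and canonical terms that are stable under substitution on the left. -/
def SubstStable (S : CanSys B D) (P : Tm S.C → Tm S.C → Prop) : Prop :=
  ∀ t ρ, P t ρ → ∀ σ : Nat → Tm S.C, P (t.bind σ) ρ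

section Oracle

variable {S : CanSys B D} {P Q : Tm S.C → Tm S.C → Prop}

namespace OStep

theorem lam_inv {t s : Tm S.C} (h : OStep S P (.lam t) s) :
    t = .app s.lift (.var 0) ∨ ∃ t', s = .lam t' ∧ OStep S P t t' := by
  cases h with
  | eta t => exact .inl rfl
  | lam h => exact .inr ⟨_, rfl, h⟩

theorem app_inv {a b s : Tm S.C} (h : OStep S P (.app a b) s) :
    (∃ t, a = .lam t ∧ s = t.subst0 b) ∨
    (∃ τ1 τ2 ρ1, τ1 ≠ .omega ∧ a ∈ S.TT (.arr τ1 τ2) ∧ ρ1 ∈ S.TT τ1 ∧ P b ρ1 ∧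
      s = S.F τ1 τ2 a ρ1) ∨
    (∃ a', s = .app a' b ∧ OStep S P a a') ∨ ∃ b', s = .app a b' ∧ OStep S P b b' := by
  cases h with
  | beta t s => exact .inl ⟨_, rfl, rfl⟩
  | crule h1 hc hρ hs => exact .inr (.inl ⟨_, _, _, h1, hc, hρ, hs, rfl⟩)
  | appL s h => exact .inr (.inr (.inl ⟨_, rfl, h⟩))
  | appR s h => exact .inr (.inr (.inr ⟨_, rfl, h⟩))

theorem not_var {n : Nat} {s : Tm S.C} : ¬ OStep S P (.var n) s := nofun

theorem not_const {c : S.C} {s : Tm S.C} : ¬ OStep S P (.const c) s := nofun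

/-- A step from an application of a constant that is not canonical takes place in the argument. -/
theorem app_const_inv {c : S.C} {b s : Tm S.C} (hc : ¬ S.Canon (.const c))
    (h : OStep S P (.app (.const c) b) s) : ∃ b', s = .app (.const c) b' ∧ OStep S P b b' := by
  rcases h.app_inv with ⟨t, e, -⟩ | ⟨τ1, τ2, ρ1, -, hm, -⟩ | ⟨a', -, h⟩ | h
  · cases e
  · exact absurd ⟨_, by simp, hm⟩ hc
  · exact absurd h not_const
  · exact h

theorem app_app_const_inv {c : S.C} {a b s : Tm S.C} (hc : ¬ S.Canon (.const c))
    (h : OStep S P (.app (.app (.const c) a) b) s) :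
    (∃ a', s = .app (.app (.const c) a') b ∧ OStep S P a a') ∨
      ∃ b', s = .app (.app (.const c) a) b' ∧ OStep S P b b' := by
  rcases h.app_inv with ⟨t, e, -⟩ | ⟨τ1, τ2, ρ1, -, hm, -⟩ | ⟨a', rfl, ha⟩ | h
  · cases e
  · exact absurd rfl (canon_ne_app ⟨_, by simp, hm⟩)
  · obtain ⟨a'', rfl, hs⟩ := app_const_inv hc ha
    exact .inl ⟨a'', rfl, hs⟩
  · exact .inr h

theorem not_of_mem {τ : ETy B} {ρ s : Tm S.C} (hτ : τ ≠ .omega) (hρ : ρ ∈ S.TT τ) :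
    ¬ OStep S P ρ s := by
  intro h
  induction τ generalizing ρ s with
  | arr τ1 τ2 _ ih2 =>
    rcases mem_cases hτ hρ with ⟨c, rfl⟩ | ⟨τ2', ρ0, e, h1, h0, rfl⟩
    · exact not_const h
    · simp only [ETy.arr.injEq] at e
      obtain ⟨-, rfl⟩ := e
      rcases h.lam_inv with e | ⟨t', -, h⟩
      · exact canon_ne_app ⟨_, h1.ne_omega, h0⟩ e
      · exact ih2 h1.ne_omega h0 h
  | _ =>
    rcases mem_cases hτ hρ with ⟨c, rfl⟩ | ⟨τ2, ρ0, e, -⟩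
    · exact not_const h
    · cases e

theorem steps_of_mem {τ : ETy B} {ρ s : Tm S.C} (hτ : τ ≠ .omega) (hρ : ρ ∈ S.TT τ)
    (h : Relation.ReflTransGen (OStep S P) ρ s) : s = ρ := by
  rcases Relation.ReflTransGen.cases_head h with e | ⟨u, h, -⟩
  · exact e.symm
  · exact absurd h (not_of_mem hτ hρ)

theorem mono (hPQ : ∀ t ρ, P t ρ → Q t ρ) {t t' : Tm S.C} (h : OStep S P t t') :
    OStep S Q t t' := by
  induction h with
  | beta t s => exact .beta t s
  | eta t => exact .eta t
  | crule h1 hc hρ hs => exact .crule h1 hc hρ (hPQ _ _ hs)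
  | appL s _ ih => exact .appL s ih
  | appR s _ ih => exact .appR s ih
  | lam _ ih => exact .lam ih

theorem bind (hP : SubstStable S P) {t t' : Tm S.C} (h : OStep S P t t') (σ : Nat → Tm S.C) :
    OStep S P (t.bind σ) (t'.bind σ) := by
  induction h generalizing σ with
  | beta t s =>
    rw [Tm.subst0_bind]
    exact .beta _ _
  | eta t =>
    rw [Tm.bind_lam, Tm.bind_app, Tm.lift_bind_up]
    exact .eta _
  | crule h1 hc hρ hs =>
    rw [Tm.bind_app, Tm.bind_of_closed (closed_of_mem (by simp) hc),
      Tm.bind_of_closed (closed_of_mem (cod_ne_omega hc) (F_mem hc hρ))]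
    exact .crule h1 hc hρ (hP _ _ hs σ)
  | appL s _ ih => exact .appL _ (ih σ)
  | appR s _ ih => exact .appR _ (ih σ)
  | lam _ ih => exact .lam (ih _)

theorem occ {t t' : Tm S.C} (h : OStep S P t t') {n : Nat} (hn : t'.Occ n) : t.Occ n := by
  induction h generalizing n with
  | beta t s => exact Tm.occ_subst0 hn
  | eta t => exact .inl (Tm.occ_lift.2 ⟨n, hn, rfl⟩)
  | crule h1 hc hρ hs => exact absurd hn (closed_of_mem (cod_ne_omega hc) (F_mem hc hρ) n)
  | appL s _ ih => exact hn.imp ih id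
  | appR s _ ih => exact hn.imp id ih
  | lam _ ih => exact ih hn

theorem of_lift (hP : SubstStable S P) {t s : Tm S.C} (h : OStep S P t.lift s) :
    ∃ s', s = s'.lift ∧ OStep S P t s' := by
  obtain ⟨s', rfl⟩ := Tm.exists_lift_of_not_occ fun h0 => Tm.not_occ_zero_lift t (h.occ h0)
  refine ⟨s', rfl, ?_⟩
  simpa only [← Tm.subst0_eq, Tm.lift_subst0] using h.bind hP (Tm.scons (.var 0) .var)

end OStep

/-- Many-step reduction with oracle. -/
abbrev OSteps (S : CanSys B D) (P : Tm S.C → Tm S.C → Prop) : Tm S.C → Tm S.C → Prop :=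
  Relation.ReflTransGen (OStep S P)

namespace OSteps

theorem appL {t t' : Tm S.C} (s : Tm S.C) (h : OSteps S P t t') :
    OSteps S P (.app t s) (.app t' s) :=
  h.lift (fun t => Tm.app t s) fun _ _ => .appL s

theorem appR (t : Tm S.C) {s s' : Tm S.C} (h : OSteps S P s s') :
    OSteps S P (.app t s) (.app t s') :=
  h.lift (fun s => Tm.app t s) fun _ _ => .appR t

theorem lam {t t' : Tm S.C} (h : OSteps S P t t') : OSteps S P (.lam t) (.lam t') :=
  h.lift Tm.lam fun _ _ => .lam

theorem bind (hP : SubstStable S P) {t t' : Tm S.C} (h : OSteps S P t t') (σ : Nat → Tm S.C) :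
    OSteps S P (t.bind σ) (t'.bind σ) :=
  h.lift (fun t => t.bind σ) fun _ _ h => h.bind hP σ

theorem mono (hPQ : ∀ t ρ, P t ρ → Q t ρ) {t t' : Tm S.C} (h : OSteps S P t t') :
    OSteps S Q t t' :=
  h.lift id fun _ _ h => h.mono hPQ

theorem lift (hP : SubstStable S P) {t t' : Tm S.C} (h : OSteps S P t t') :
    OSteps S P t.lift t'.lift := by
  rw [Tm.lift_eq_bind, Tm.lift_eq_bind]
  exact h.bind hP _

theorem bind_right (hP : SubstStable S P) (t : Tm S.C) {σ σ' : Nat → Tm S.C}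
    (h : ∀ n, OSteps S P (σ n) (σ' n)) : OSteps S P (t.bind σ) (t.bind σ') := by
  induction t generalizing σ σ' with
  | var n => exact h n
  | const c => exact .refl
  | app a b iha ihb => exact ((iha h).appL _).trans ((ihb h).appR _)
  | lam a ih =>
    refine (ih fun n => ?_).lam
    cases n with
    | zero => exact .refl
    | succ m => exact (h m).lift hP

theorem subst0 (hP : SubstStable S P) {t t' s s' : Tm S.C} (ht : OSteps S P t t')
    (hs : OSteps S P s s') : OSteps S P (t.subst0 s) (t'.subst0 s') := by
  rw [Tm.subst0_eq, Tm.subst0_eq]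
  refine (ht.bind hP _).trans (bind_right hP t' fun n => ?_)
  cases n with
  | zero => exact hs
  | succ m => exact .refl

theorem app_const_inv {c : S.C} {b s : Tm S.C} (hc : ¬ S.Canon (.const c))
    (h : OSteps S P (.app (.const c) b) s) : ∃ b', s = .app (.const c) b' ∧ OSteps S P b b' := by
  induction h with
  | refl => exact ⟨b, rfl, .refl⟩
  | tail _ h ih =>
    obtain ⟨b', rfl, hb⟩ := ih
    obtain ⟨b'', rfl, hs⟩ := h.app_const_inv hc
    exact ⟨b'', rfl, hb.tail hs⟩

theorem app_app_const_inv {c : S.C} {a b s : Tm S.C} (hc : ¬ S.Canon (.const c))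
    (h : OSteps S P (.app (.app (.const c) a) b) s) :
    ∃ a' b', s = .app (.app (.const c) a') b' ∧ OSteps S P a a' ∧ OSteps S P b b' := by
  induction h with
  | refl => exact ⟨a, b, rfl, .refl, .refl⟩
  | tail _ h ih =>
    obtain ⟨a', b', rfl, ha, hb⟩ := ih
    rcases h.app_app_const_inv hc with ⟨a'', rfl, hs⟩ | ⟨b'', rfl, hs⟩
    · exact ⟨a'', b', rfl, ha.tail hs, hb⟩
    · exact ⟨a', b'', rfl, ha, hb.tail hs⟩

end OSteps

theorem OStep.K_inv (hP : SubstStable S P) {t s : Tm S.C} (h : OStep S P (S.Kt t) s) :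
    ∃ t', s = S.Kt t' ∧ OStep S P t t' := by
  rcases h.lam_inv with e | ⟨t', rfl, ht⟩
  · obtain ⟨a', b', -, -, e⟩ := Tm.lift_eq_app e
    exact absurd (show Tm.Occ 0 (Tm.var 0 : Tm S.C) from rfl) (e ▸ Tm.not_occ_zero_lift b')
  · obtain ⟨t', rfl, hs⟩ := ht.of_lift hP
    exact ⟨t', rfl, hs⟩

theorem OSteps.K_inv (hP : SubstStable S P) {t s : Tm S.C} (h : OSteps S P (S.Kt t) s) :
    ∃ t', s = S.Kt t' ∧ OSteps S P t t' := by
  induction h with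
  | refl => exact ⟨t, rfl, .refl⟩
  | tail _ h ih =>
    obtain ⟨t', rfl, ht⟩ := ih
    obtain ⟨t'', rfl, hs⟩ := h.K_inv hP
    exact ⟨t'', rfl, ht.tail hs⟩

namespace OPar

theorem lam_inv {t s : Tm S.C} (h : OPar S P (.lam t) s) :
    (∃ t', s = .lam t' ∧ OPar S P t t') ∨ ∃ u, t = .app u.lift (.var 0) ∧ OPar S P u s := by
  cases h with
  | lam h => exact .inl ⟨_, rfl, h⟩
  | eta h => exact .inr ⟨_, rfl, h⟩

theorem app_inv {a b s : Tm S.C} (h : OPar S P (.app a b) s) :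
    (∃ a' b', s = .app a' b' ∧ OPar S P a a' ∧ OPar S P b b') ∨
    (∃ t t' b', a = .lam t ∧ s = t'.subst0 b' ∧ OPar S P t t' ∧ OPar S P b b') ∨
    (∃ τ1 τ2 ρ1, τ1 ≠ .omega ∧ a ∈ S.TT (.arr τ1 τ2) ∧ ρ1 ∈ S.TT τ1 ∧ P b ρ1 ∧
      s = S.F τ1 τ2 a ρ1) := by
  cases h with
  | app ha hb => exact .inl ⟨_, _, rfl, ha, hb⟩
  | beta ht hs => exact .inr (.inl ⟨_, _, _, rfl, rfl, ht, hs⟩)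
  | crule h1 hc hρ hs => exact .inr (.inr ⟨_, _, _, h1, hc, hρ, hs, rfl⟩)

theorem var_inv {n : Nat} {s : Tm S.C} (h : OPar S P (.var n) s) : s = .var n := by
  cases h
  rfl

theorem const_inv {c : S.C} {s : Tm S.C} (h : OPar S P (.const c) s) : s = .const c := by
  cases h
  rfl

@[refl] theorem refl (t : Tm S.C) : OPar S P t t := by
  induction t with
  | var n => exact .var n
  | const c => exact .const c
  | app a b iha ihb => exact .app iha ihb
  | lam a ih => exact .lam ih

theorem of_step {t s : Tm S.C} (h : OStep S P t s) : OPar S P t s := by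
  induction h with
  | beta t s => exact .beta (refl t) (refl s)
  | eta t => exact .eta (refl t)
  | crule h1 hc hρ hs => exact .crule h1 hc hρ hs
  | appL s _ ih => exact .app ih (refl s)
  | appR s _ ih => exact .app (refl s) ih
  | lam _ ih => exact .lam ih

theorem steps (hP : SubstStable S P) {t s : Tm S.C} (h : OPar S P t s) : OSteps S P t s := by
  induction h with
  | var n => exact .refl
  | const c => exact .refl
  | app _ _ iha ihb => exact (iha.appL _).trans (ihb.appR _)
  | lam _ ih => exact ih.lam
  | beta _ _ iht ihs => exact .head (.beta _ _) (iht.subst0 hP ihs)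
  | eta _ ih => exact .head (.eta _) ih
  | crule h1 hc hρ hs => exact .single (.crule h1 hc hρ hs)

theorem occ {t t' : Tm S.C} (h : OPar S P t t') {n : Nat} (hn : t'.Occ n) : t.Occ n := by
  induction h generalizing n with
  | var n => exact hn
  | const c => exact hn
  | app _ _ iha ihb => exact hn.imp iha ihb
  | lam _ ih => exact ih hn
  | beta _ _ iht ihs => exact (Tm.occ_subst0 hn).imp iht ihs
  | eta _ ih => exact .inl (Tm.occ_lift.2 ⟨n, ih hn, rfl⟩)
  | crule h1 hc hρ hs => exact absurd hn (closed_of_mem (cod_ne_omega hc) (F_mem hc hρ) n)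

theorem bind_left (hP : SubstStable S P) {t t' : Tm S.C} (h : OPar S P t t')
    (σ : Nat → Tm S.C) : OPar S P (t.bind σ) (t'.bind σ) := by
  induction h generalizing σ with
  | var n => exact refl _
  | const c => exact refl _
  | app _ _ iha ihb => exact .app (iha σ) (ihb σ)
  | lam _ ih => exact .lam (ih _)
  | beta _ _ iht ihs =>
    rw [Tm.subst0_bind]
    exact .beta (iht _) (ihs _)
  | eta _ ih =>
    rw [Tm.bind_lam, Tm.bind_app, Tm.lift_bind_up]
    exact .eta (ih σ)
  | crule h1 hc hρ hs =>
    rw [Tm.bind_app, Tm.bind_of_closed (closed_of_mem (by simp) hc),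
      Tm.bind_of_closed (closed_of_mem (cod_ne_omega hc) (F_mem hc hρ))]
    exact .crule h1 hc hρ (hP _ _ hs σ)

theorem lift (hP : SubstStable S P) {t t' : Tm S.C} (h : OPar S P t t') :
    OPar S P t.lift t'.lift := by
  rw [Tm.lift_eq_bind, Tm.lift_eq_bind]
  exact h.bind_left hP _

theorem bind (hP : SubstStable S P) {t t' : Tm S.C} (h : OPar S P t t')
    {σ σ' : Nat → Tm S.C} (hσ : ∀ n, OPar S P (σ n) (σ' n)) :
    OPar S P (t.bind σ) (t'.bind σ') := by
  have up {σ σ' : Nat → Tm S.C} (hσ : ∀ n, OPar S P (σ n) (σ' n)) (n : Nat) :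
      OPar S P (Tm.up σ n) (Tm.up σ' n) := by
    cases n with
    | zero => exact refl _
    | succ m => exact (hσ m).lift hP
  induction h generalizing σ σ' with
  | var n => exact hσ n
  | const c => exact refl _
  | app _ _ iha ihb => exact .app (iha hσ) (ihb hσ)
  | lam _ ih => exact .lam (ih (up hσ))
  | beta _ _ iht ihs =>
    rw [Tm.subst0_bind]
    exact .beta (iht (up hσ)) (ihs hσ)
  | eta _ ih =>
    rw [Tm.bind_lam, Tm.bind_app, Tm.lift_bind_up]
    exact .eta (ih hσ)
  | crule h1 hc hρ hs =>
    rw [Tm.bind_app, Tm.bind_of_closed (closed_of_mem (by simp) hc),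
      Tm.bind_of_closed (closed_of_mem (cod_ne_omega hc) (F_mem hc hρ))]
    exact .crule h1 hc hρ (hP _ _ hs σ)

theorem subst0 (hP : SubstStable S P) {t t' s s' : Tm S.C} (ht : OPar S P t t')
    (hs : OPar S P s s') : OPar S P (t.subst0 s) (t'.subst0 s') := by
  rw [Tm.subst0_eq, Tm.subst0_eq]
  refine ht.bind hP fun n => ?_
  cases n with
  | zero => exact hs
  | succ m => exact refl _

theorem of_lift (hP : SubstStable S P) {t s : Tm S.C} (h : OPar S P t.lift s) :
    ∃ s', s = s'.lift ∧ OPar S P t s' := by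
  obtain ⟨s', rfl⟩ := Tm.exists_lift_of_not_occ fun h0 => Tm.not_occ_zero_lift t (h.occ h0)
  refine ⟨s', rfl, ?_⟩
  simpa only [← Tm.subst0_eq, Tm.lift_subst0] using h.bind_left hP (Tm.scons (.var 0) .var)

theorem eta_body_inv (hP : SubstStable S P) (hPv : ∀ n ρ, ¬ P (.var n) ρ) {t s : Tm S.C}
    (h : OPar S P (.app t.lift (.var 0)) s) :
    (∃ t', s = .app t'.lift (.var 0) ∧ OPar S P t t') ∨ ∃ u, t = .lam u ∧ OPar S P u s := by
  rcases h.app_inv with ⟨a', b', rfl, ha, hb⟩ | ⟨u, u', b', e, rfl, hu, hb⟩ |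
    ⟨τ1, τ2, ρ1, -, -, -, hv, -⟩
  · obtain ⟨t', rfl, ht⟩ := ha.of_lift hP
    rw [hb.var_inv]
    exact .inl ⟨t', rfl, ht⟩
  · obtain ⟨u0, rfl, rfl⟩ := Tm.lift_eq_lam e
    refine .inr ⟨u0, rfl, ?_⟩
    have := hu.subst0 hP hb
    rw [Tm.bind_up_succ_subst0_zero] at this
    rwa [hb.var_inv] at this ⊢
  · exact absurd hv (hPv _ _)

/-- Parallel reductions for two oracles that agree on canonical values and are invariant under each
other's reductions have the diamond property. -/
theorem diamond (hP : SubstStable S P) (hQ : SubstStable S Q) (hPv : ∀ n ρ, ¬ P (.var n) ρ)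
    (hQv : ∀ n ρ, ¬ Q (.var n) ρ)
    (hPQ : ∀ t τ ρ ρ', τ ≠ .omega → ρ ∈ S.TT τ → ρ' ∈ S.TT τ → P t ρ → Q t ρ' → ρ = ρ')
    (hPp : ∀ t t' ρ, P t ρ → OPar S Q t t' → P t' ρ)
    (hQp : ∀ t t' ρ, Q t ρ → OPar S P t t' → Q t' ρ) {t u v : Tm S.C} (hu : OPar S P t u)
    (hv : OPar S Q t v) : ∃ w, OPar S Q u w ∧ OPar S P v w := by
  induction hn : t.size using Nat.strong_induction_on generalizing t u v with
  | _ n ih =>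
  subst hn
  have ih' {t' u v : Tm S.C} (hu : OPar S P t' u) (hv : OPar S Q t' v) (hs : t'.size < t.size) :
      ∃ w, OPar S Q u w ∧ OPar S P v w := ih _ hs hu hv rfl
  clear ih
  cases t with
  | var n => exact ⟨.var n, by rw [hu.var_inv], by rw [hv.var_inv]⟩
  | const c => exact ⟨.const c, by rw [hu.const_inv], by rw [hv.const_inv]⟩
  | lam b =>
    rcases hu.lam_inv with ⟨b', rfl, hb⟩ | ⟨t0, rfl, ht⟩ <;>
      rcases hv.lam_inv with ⟨b'', rfl, hb2⟩ | ⟨t1, e, ht2⟩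
    · obtain ⟨w, h1, h2⟩ := ih' hb hb2 (by simp [Tm.size])
      exact ⟨_, .lam h1, .lam h2⟩
    · subst e
      rcases hb.eta_body_inv hP hPv with ⟨t', rfl, ht⟩ | ⟨u, rfl, hu'⟩
      · obtain ⟨w, h1, h2⟩ := ih' ht ht2 (by simp [Tm.size]; omega)
        exact ⟨w, .eta h1, h2⟩
      · exact ih' (.lam hu') ht2 (by simp [Tm.size])
    · rcases hb2.eta_body_inv hQ hQv with ⟨t', rfl, ht2⟩ | ⟨u, rfl, hu'⟩
      · obtain ⟨w, h1, h2⟩ := ih' ht ht2 (by simp [Tm.size]; omega)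
        exact ⟨w, h1, .eta h2⟩
      · exact ih' ht (.lam hu') (by simp [Tm.size])
    · simp only [Tm.app.injEq, and_true] at e
      rw [← Tm.lift_injective e] at ht2
      exact ih' ht ht2 (by simp [Tm.size]; omega)
  | app a b =>
    rcases hu.app_inv with ⟨a', b', rfl, ha, hb⟩ | ⟨t, t', b', rfl, rfl, ht, hb⟩ |
        ⟨τ1, τ2, ρ1, hτ, hm, hρ, hp, rfl⟩ <;>
      rcases hv.app_inv with ⟨a'', b'', rfl, ha2, hb2⟩ | ⟨s, s', b'', e, rfl, hs2, hb2⟩ |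
        ⟨τ1', τ2', ρ1', hτ', hm', hρ', hp', rfl⟩
    · obtain ⟨w, h1, h2⟩ := ih' ha ha2 (by simp [Tm.size])
      obtain ⟨x, h3, h4⟩ := ih' hb hb2 (by simp [Tm.size])
      exact ⟨_, .app h1 h3, .app h2 h4⟩
    · subst e
      rcases ha.lam_inv with ⟨t', rfl, ht⟩ | ⟨t0, rfl, ht⟩
      · obtain ⟨w, h1, h2⟩ := ih' ht hs2 (by simp [Tm.size]; omega)
        obtain ⟨x, h3, h4⟩ := ih' hb hb2 (by simp [Tm.size])
        exact ⟨_, .beta h1 h3, h2.subst0 hP h4⟩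
      · rcases hs2.eta_body_inv hQ hQv with ⟨t1, rfl, ht1⟩ | ⟨b0, rfl, hb0⟩
        · obtain ⟨w, h1, h2⟩ := ih' ht ht1 (by simp [Tm.size]; omega)
          obtain ⟨x, h3, h4⟩ := ih' hb hb2 (by simp [Tm.size])
          refine ⟨_, .app h1 h3, ?_⟩
          have : (Tm.app t1.lift (.var 0)).subst0 b'' = .app t1 b'' := by
            conv_rhs => rw [← Tm.lift_subst0 t1 b'']
            rfl
          rw [this]
          exact .app h2 h4
        · exact ih' (.app ht hb) (.beta hb0 hb2) (by simp [Tm.size])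
    · obtain ⟨c, rfl⟩ := const_of_mem_arr hτ' hm'
      rw [ha.const_inv]
      exact ⟨_, .crule hτ' hm' hρ' (hQp _ _ _ hp' hb), refl _⟩
    · rcases ha2.lam_inv with ⟨s', rfl, hs⟩ | ⟨t0, rfl, hs⟩
      · obtain ⟨w, h1, h2⟩ := ih' ht hs (by simp [Tm.size]; omega)
        obtain ⟨x, h3, h4⟩ := ih' hb hb2 (by simp [Tm.size])
        exact ⟨_, h1.subst0 hQ h3, .beta h2 h4⟩
      · rcases ht.eta_body_inv hP hPv with ⟨t1, rfl, ht1⟩ | ⟨b0, rfl, hb0⟩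
        · obtain ⟨w, h1, h2⟩ := ih' ht1 hs (by simp [Tm.size]; omega)
          obtain ⟨x, h3, h4⟩ := ih' hb hb2 (by simp [Tm.size])
          refine ⟨_, ?_, .app h2 h4⟩
          have : (Tm.app t1.lift (.var 0)).subst0 b' = .app t1 b' := by
            conv_rhs => rw [← Tm.lift_subst0 t1 b']
            rfl
          rw [this]
          exact .app h1 h3
        · exact ih' (.beta hb0 hb) (.app hs hb2) (by simp [Tm.size])
    · cases e
      obtain ⟨w, h1, h2⟩ := ih' ht hs2 (by simp [Tm.size]; omega)
      obtain ⟨x, h3, h4⟩ := ih' hb hb2 (by simp [Tm.size])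
      exact ⟨_, h1.subst0 hQ h3, h2.subst0 hP h4⟩
    · obtain ⟨c, e⟩ := const_of_mem_arr hτ' hm'
      cases e
    · obtain ⟨c, rfl⟩ := const_of_mem_arr hτ hm
      rw [ha2.const_inv]
      exact ⟨_, refl _, .crule hτ hm hρ (hPp _ _ _ hp hb2)⟩
    · obtain ⟨c, rfl⟩ := const_of_mem_arr hτ hm
      cases e
    · have e := type_unique (by simp) (by simp) hm hm'
      simp only [ETy.arr.injEq] at e
      obtain ⟨rfl, rfl⟩ := e
      rw [hPQ _ _ _ _ hτ hρ hρ' hp hp']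
      exact ⟨_, refl _, refl _⟩

end OPar

/-- Two relations with the joint diamond property have commuting reflexive-transitive closures. -/
theorem reflTransGen_commute {α : Type*} {r s : α → α → Prop}
    (h : ∀ a b c, r a b → s a c → ∃ d, s b d ∧ r c d) {a b c : α}
    (hb : Relation.ReflTransGen r a b) (hc : Relation.ReflTransGen s a c) :
    ∃ d, Relation.ReflTransGen s b d ∧ Relation.ReflTransGen r c d := by
  have strip {a b c : α} (hab : r a b) (hac : Relation.ReflTransGen s a c) :
      ∃ d, Relation.ReflTransGen s b d ∧ r c d := by
    induction hac with
    | refl => exact ⟨b, .refl, hab⟩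
    | tail _ hs ih =>
      obtain ⟨d, hd, hr⟩ := ih
      obtain ⟨e, he, hr'⟩ := h _ _ _ hr hs
      exact ⟨e, hd.tail he, hr'⟩
  induction hb with
  | refl => exact ⟨c, hc, .refl⟩
  | tail _ hr ih =>
    obtain ⟨d, hd, hr'⟩ := ih
    obtain ⟨e, he, hr''⟩ := strip hr hd
    exact ⟨e, he, hr'.tail hr''⟩

theorem OSteps.preserve (h : ∀ t t' ρ, P t ρ → OStep S Q t t' → P t' ρ) {t t' ρ : Tm S.C}
    (hr : P t ρ) (ht : OSteps S Q t t') : P t' ρ := by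
  induction ht with
  | refl => exact hr
  | tail _ hs ih => exact h _ _ _ ih hs

theorem OSteps.commute (hP : SubstStable S P) (hQ : SubstStable S Q)
    (hPv : ∀ n ρ, ¬ P (.var n) ρ) (hQv : ∀ n ρ, ¬ Q (.var n) ρ)
    (hPQ : ∀ t τ ρ ρ', τ ≠ .omega → ρ ∈ S.TT τ → ρ' ∈ S.TT τ → P t ρ → Q t ρ' → ρ = ρ')
    (hPp : ∀ t t' ρ, P t ρ → OStep S Q t t' → P t' ρ)
    (hQp : ∀ t t' ρ, Q t ρ → OStep S P t t' → Q t' ρ) {t u v : Tm S.C} (hu : OSteps S P t u)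
    (hv : OSteps S Q t v) : ∃ w, OSteps S Q u w ∧ OSteps S P v w := by
  have par {R : Tm S.C → Tm S.C → Prop} (hR : SubstStable S R) {t t' : Tm S.C}
      (h : Relation.ReflTransGen (OPar S R) t t') : OSteps S R t t' := by
    induction h with
    | refl => exact .refl
    | tail _ hs ih => exact ih.trans (hs.steps hR)
  obtain ⟨w, h1, h2⟩ := reflTransGen_commute
    (fun _ _ _ h1 h2 => OPar.diamond hP hQ hPv hQv hPQ
      (fun _ _ _ hp h => (h.steps hQ).preserve hPp hp)
      (fun _ _ _ hp h => (h.steps hP).preserve hQp hp) h1 h2)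
    (Relation.ReflTransGen.lift id (fun _ _ h => OPar.of_step h) _ _ hu)
    (Relation.ReflTransGen.lift id (fun _ _ h => OPar.of_step h) _ _ hv)
  exact ⟨w, par hQ h1, par hP h2⟩

end Oracle

/-! ### An auxiliary extended system

The extended system has more typing rules and weaker side conditions, so that typing and values are
preserved by reduction, including `η`-contractions of `F t₁ t₂`. -/

section Extended

/-- The substitution `z ↦ f x` used in the body of `F t₁ (λz.q)`. -/
def fsub {C : Type} : Nat → Tm C := Tm.scons (.app (.var 1) (.var 0)) fun m => .var (m + 2)

/-- The term `λf. Ξ a s`, where `f` does not occur in `a`. -/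
def CanSys.xiLam (S : CanSys B D) (a s : Tm S.C) : Tm S.C := .lam (.app (.app S.XiT a.lift) s)

/-- Typing relative to a relation `Ld t ρ`. -/
inductive XTy (S : CanSys B D) (Ld : Tm S.C → Tm S.C → Prop) : Tm S.C → ETy B → Prop
  | base (b : B) : XTy S Ld (S.AT b) (.base b)
  | baseEta (b : B) : XTy S Ld (.lam (.app (S.AT b) (.var 0))) (.base b)
  | prop : XTy S Ld S.Hterm .o
  | kTop {t : Tm S.C} : Ld t S.top → XTy S Ld (S.Kt t) .omega
  | kBot {t : Tm S.C} : Ld t S.bot → XTy S Ld (S.Kt t) .eps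
  | func {a q : Tm S.C} {τ1 τ2 : ETy B} : XTy S Ld a τ1 → XTy S Ld (.lam q) τ2 →
      XTy S Ld (S.xiLam a (.lam (q.bind fsub))) (arrN τ1 τ2)
  | funcEps {a : Tm S.C} (s : Tm S.C) : XTy S Ld a .eps → XTy S Ld (S.xiLam a s) .omega
  | xiEps {a : Tm S.C} : XTy S Ld a .eps → XTy S Ld (.app S.XiT a) .omega

/-- Canonical values relative to a relation `Ld t ρ`. -/
inductive XVal (S : CanSys B D) (Ld : Tm S.C → Tm S.C → Prop) : Tm S.C → Tm S.C → Prop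
  | refl {τ : ETy B} (hτ : τ ≠ .omega) {ρ : Tm S.C} (hρ : ρ ∈ S.TT τ) : XVal S Ld ρ ρ
  | fn {τ1 τ2 : ETy B} {ρ : Tm S.C} (hρ : ρ ∈ S.TT (.arr τ1 τ2)) {t : Tm S.C}
      (h : ∀ t1 ∈ S.TT τ1, Ld (.app t t1) (S.F τ1 τ2 ρ t1)) : XVal S Ld t ρ
  | topL (t : Tm S.C) : XVal S Ld (.app S.LT t) S.top
  | topA (b : B) (t : Tm S.C) : XVal S Ld (.app (S.AT b) t) S.top
  | xiTop {a s : Tm S.C} {τ : ETy B} (h1 : XTy S Ld a τ)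
      (h2 : ∀ t ∈ S.TT τ, Ld (.app s t) S.top) : XVal S Ld (.app (.app S.XiT a) s) S.top
  | xiBot {a s : Tm S.C} {τ : ETy B} (h1 : XTy S Ld a τ) {t : Tm S.C} (ht : t ∈ S.TT τ)
      (hb : Ld (.app s t) S.bot) : XVal S Ld (.app (.app S.XiT a) s) S.bot

/-- The canonical values at stage `α` of the extended system. -/
def XSucc (S : CanSys B D) (α : Ordinal.{0}) : Tm S.C → Tm S.C → Prop :=
  XVal S fun t ρ => ∃ (γ : Ordinal.{0}) (_ : γ < α) (t' : Tm S.C),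
    OSteps S (fun t ρ => (t = ρ ∧ S.Canon ρ) ∨ ∃ (δ : Ordinal.{0}) (_ : δ < γ), XSucc S δ t ρ) t t' ∧
      XSucc S γ t' ρ
termination_by α
decreasing_by all_goals first | assumption | exact lt_trans ‹_› ‹_›

/-- The rules `c t → F(c)(ρ)` available at stage `γ` of the extended system. -/
def XOracle (S : CanSys B D) (γ : Ordinal.{0}) (t ρ : Tm S.C) : Prop :=
  (t = ρ ∧ S.Canon ρ) ∨ ∃ δ < γ, XSucc S δ t ρ

/-- Reduction to a term with a canonical value at a stage before `α`. -/
def XLead (S : CanSys B D) (α : Ordinal.{0}) (t ρ : Tm S.C) : Prop :=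
  ∃ γ < α, ∃ t', OSteps S (XOracle S γ) t t' ∧ XSucc S γ t' ρ

variable {S : CanSys B D}

theorem xSucc_eq (α : Ordinal.{0}) : XSucc S α = XVal S (XLead S α) := by
  rw [XSucc]
  congr! 3 with t ρ
  simp only [XLead, exists_prop]
  rfl

theorem CanSys.xiLam_inj {a a' s s' : Tm S.C} (h : S.xiLam a s = S.xiLam a' s') :
    a = a' ∧ s = s' := by
  simp only [CanSys.xiLam, Tm.lam.injEq, Tm.app.injEq, true_and] at h
  exact ⟨Tm.lift_injective h.1, h.2⟩

section Basic

variable {Ld Ld' : Tm S.C → Tm S.C → Prop}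

theorem XTy.mono (h : ∀ t ρ, Ld t ρ → Ld' t ρ) {t : Tm S.C} {τ : ETy B} (ht : XTy S Ld t τ) :
    XTy S Ld' t τ := by
  induction ht with
  | base b => exact .base b
  | baseEta b => exact .baseEta b
  | prop => exact .prop
  | kTop ht => exact .kTop (h _ _ ht)
  | kBot ht => exact .kBot (h _ _ ht)
  | func _ _ ih1 ih2 => exact .func ih1 ih2
  | funcEps s _ ih => exact .funcEps s ih
  | xiEps _ ih => exact .xiEps ih

theorem XTy.isTp {t : Tm S.C} {τ : ETy B} (ht : XTy S Ld t τ) : IsTp τ := by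
  induction ht with
  | base b => exact .inl (.base b)
  | baseEta b => exact .inl (.base b)
  | prop => exact .inl .o
  | func _ _ ih1 ih2 => exact ih1.arrN ih2
  | kBot _ => exact .inr (.inr rfl)
  | _ => exact .inr (.inl rfl)

theorem XTy.not_id {τ : ETy B} : ¬ XTy S Ld (.lam (.var 0)) τ := by
  intro h
  generalize e : (Tm.lam (.var 0) : Tm S.C) = t at h
  cases h with
  | kTop _ | kBot _ =>
    simp only [CanSys.Kt, Tm.lam.injEq] at e
    exact absurd (show Tm.Occ 0 (Tm.var 0 : Tm S.C) from rfl) (e ▸ Tm.not_occ_zero_lift _)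
  | _ => cases e

theorem fsub_bind (q : Tm S.C) (σ : Nat → Tm S.C) :
    (q.bind fsub).bind (Tm.up (Tm.up σ)) = (q.bind (Tm.up σ)).bind fsub := by
  rw [Tm.bind_bind, Tm.bind_bind]
  congr 1
  funext n
  cases n with
  | zero => rfl
  | succ m =>
    rw [Tm.up_succ, Tm.lift_bind]
    change ((σ m).lift).lift = _
    rw [Tm.lift_eq_bind, Tm.lift_bind]
    rfl

theorem CanSys.Kt_bind (t : Tm S.C) (σ : Nat → Tm S.C) : (S.Kt t).bind σ = S.Kt (t.bind σ) := by
  rw [CanSys.Kt, Tm.bind_lam, Tm.lift_bind_up]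
  rfl

theorem CanSys.xiLam_bind (a s : Tm S.C) (σ : Nat → Tm S.C) :
    (S.xiLam a s).bind σ = S.xiLam (a.bind σ) (s.bind (Tm.up σ)) := by
  simp only [CanSys.xiLam, Tm.bind_lam, Tm.bind_app, Tm.lift_bind_up]
  rfl

theorem XTy.bind (hLd : SubstStable S Ld) {t : Tm S.C} {τ : ETy B} (ht : XTy S Ld t τ)
    (σ : Nat → Tm S.C) : XTy S Ld (t.bind σ) τ := by
  induction ht generalizing σ with
  | base b => exact .base b
  | baseEta b => exact .baseEta b
  | prop => exact .prop
  | kTop ht => exact S.Kt_bind _ σ ▸ .kTop (hLd _ _ ht σ)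
  | kBot ht => exact S.Kt_bind _ σ ▸ .kBot (hLd _ _ ht σ)
  | func _ _ ih1 ih2 =>
    rw [CanSys.xiLam_bind, Tm.bind_lam, fsub_bind]
    exact .func (ih1 σ) (ih2 σ)
  | funcEps s _ ih => exact CanSys.xiLam_bind (S := S) _ s σ ▸ .funcEps _ (ih σ)
  | xiEps _ ih => exact .xiEps (ih σ)

/-- If `u t` is related to `f t` for all `t ∈ T_τ`, so is `u[σ] t`, provided that `f` is constant
when `τ = ω`. -/
theorem SubstStable.bind_fun (hLd : SubstStable S Ld) {τ : ETy B} {u : Tm S.C}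
    {f : Tm S.C → Tm S.C} (hf : τ = .omega → ∀ t t', f t = f t')
    (h : ∀ t ∈ S.TT τ, Ld (.app u t) (f t)) (σ : Nat → Tm S.C) :
    ∀ t ∈ S.TT τ, Ld (.app (u.bind σ) t) (f t) := by
  intro t ht
  by_cases hτ : τ = .omega
  · obtain ⟨n, hn⟩ := Tm.exists_fresh_bind u
    obtain ⟨σ', e1, e2⟩ := hn t σ
    have := hLd _ _ (h (.var n) (by rw [hτ, S.TT_omega]; trivial)) σ'
    rwa [Tm.bind_app, e1, Tm.bind_var_apply, e2, hf hτ _ t] at this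
  · have := hLd _ _ (h t ht) σ
    rwa [Tm.bind_app, Tm.bind_of_closed (closed_of_mem hτ ht)] at this

theorem F_omega_const {τ2 : ETy B} {ρ : Tm S.C} (hρ : ρ ∈ S.TT (.arr .omega τ2)) (t t' : Tm S.C) :
    S.F .omega τ2 ρ t = S.F .omega τ2 ρ t' := by
  have h1 := (isT1_of_mem (by simp) hρ).arr_right
  rw [S.TT_omega_arr τ2 h1] at hρ
  obtain ⟨ρ0, h0, rfl⟩ := hρ
  rw [S.F_omega τ2 ρ0 h0, S.F_omega τ2 ρ0 h0]

theorem mem_bind {τ : ETy B} {t : Tm S.C} (ht : t ∈ S.TT τ) (σ : Nat → Tm S.C) :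
    t.bind σ ∈ S.TT τ := by
  by_cases hτ : τ = .omega
  · rw [hτ, S.TT_omega]
    trivial
  · rwa [Tm.bind_of_closed (closed_of_mem hτ ht)]

theorem XVal.substStable (hLd : SubstStable S Ld) : SubstStable S (XVal S Ld) := by
  intro t ρ h σ
  cases h with
  | refl hτ hρ =>
    rw [Tm.bind_of_closed (closed_of_mem hτ hρ)]
    exact .refl hτ hρ
  | fn hρ hf =>
    refine .fn hρ (hLd.bind_fun ?_ hf σ)
    rintro rfl
    exact F_omega_const hρ
  | topL t => exact .topL _
  | topA b t => exact .topA b _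
  | xiTop h1 h2 => exact .xiTop (h1.bind hLd σ) (hLd.bind_fun (fun _ _ _ => rfl) h2 σ)
  | xiBot h1 h3 hb => exact .xiBot (h1.bind hLd σ) (mem_bind h3 σ) (hLd _ _ hb σ)

end Basic

theorem XSucc.substStable (α : Ordinal.{0}) : SubstStable S (XSucc S α) := by
  induction α using WellFoundedLT.induction with
  | _ α ih =>
  rw [xSucc_eq]
  refine XVal.substStable ?_
  rintro t ρ ⟨γ, hγ, t', h1, h2⟩ σ
  refine ⟨γ, hγ, t'.bind σ, h1.bind ?_ σ, ih γ hγ _ _ h2 σ⟩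
  rintro t ρ (⟨rfl, hc⟩ | ⟨δ, hδ, h⟩) σ
  · obtain ⟨τ, hτ, hm⟩ := hc
    exact .inl ⟨Tm.bind_of_closed (closed_of_mem hτ hm) σ, τ, hτ, hm⟩
  · exact .inr ⟨δ, hδ, ih δ (hδ.trans hγ) _ _ h σ⟩

theorem XOracle.substStable (α : Ordinal.{0}) : SubstStable S (XOracle S α) := by
  rintro t ρ (⟨rfl, hc⟩ | ⟨δ, hδ, h⟩) σ
  · obtain ⟨τ, hτ, hm⟩ := hc
    exact .inl ⟨Tm.bind_of_closed (closed_of_mem hτ hm) σ, τ, hτ, hm⟩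
  · exact .inr ⟨δ, hδ, XSucc.substStable δ _ _ h σ⟩

theorem XLead.mono {α β : Ordinal.{0}} (h : α ≤ β) {t ρ : Tm S.C} (ht : XLead S α t ρ) :
    XLead S β t ρ := by
  obtain ⟨γ, hγ, hs⟩ := ht
  exact ⟨γ, hγ.trans_le h, hs⟩

/-- Variables applied to arguments. -/
inductive Tm.Neutral {C : Type} : Tm C → Prop
  | var (n : Nat) : Neutral (.var n)
  | app {t : Tm C} (s : Tm C) : Neutral t → Neutral (.app t s)

theorem Tm.Neutral.not_canon {t : Tm S.C} (h : t.Neutral) : ¬ S.Canon t := by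
  intro hc
  cases h with
  | var n => exact canon_ne_var hc rfl
  | app s _ => exact canon_ne_app hc rfl

theorem Tm.Neutral.step {P : Tm S.C → Tm S.C → Prop} {t s : Tm S.C} (h : t.Neutral)
    (hs : OStep S P t s) : s.Neutral := by
  induction h generalizing s with
  | var n => exact absurd hs OStep.not_var
  | @app t u ht ih =>
    rcases hs.app_inv with ⟨b, rfl, -⟩ | ⟨τ1, τ2, ρ1, -, hm, -⟩ | ⟨a', rfl, ha⟩ | ⟨b', rfl, -⟩
    · cases ht
    · exact absurd ⟨_, by simp, hm⟩ ht.not_canon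
    · exact .app _ (ih ha)
    · exact .app _ ht

theorem Tm.Neutral.not_xSucc (hD : ∀ b, Nonempty (D b)) {α : Ordinal.{0}} {t ρ : Tm S.C}
    (h : t.Neutral) : ¬ XSucc S α t ρ := by
  induction α using WellFoundedLT.induction generalizing t ρ with
  | _ α ih =>
  intro hs
  rw [xSucc_eq] at hs
  cases hs with
  | refl hτ hρ => exact h.not_canon ⟨_, hτ, hρ⟩
  | fn hρ hf =>
    obtain ⟨t1, h1⟩ := nonempty_dom hD hρ
    obtain ⟨γ, hγ, t', hst, hs⟩ := hf t1 h1
    refine ih γ hγ ?_ hs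
    clear hs
    induction hst with
    | refl => exact .app _ h
    | tail _ hs ih => exact ih.step hs
  | topL t | topA b t => cases h with | app _ h => cases h
  | xiTop _ _ | xiBot _ _ _ => cases h with | app _ h => cases h with | app _ h => cases h

theorem XOracle.not_var (hD : ∀ b, Nonempty (D b)) (α : Ordinal.{0}) (n : Nat) (ρ : Tm S.C) :
    ¬ XOracle S α (.var n) ρ := by
  rintro (⟨rfl, hc⟩ | ⟨δ, -, h⟩)
  · exact canon_ne_var hc rfl
  · exact (Tm.Neutral.var n).not_xSucc hD h

/-- Substitutions of variables and terms `x y` for variables. -/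
def Rigid {C : Type} (σ : Nat → Tm C) : Prop :=
  ∀ i, (∃ m, σ i = .var m) ∨ ∃ m n, σ i = .app (.var m) (.var n)

theorem Rigid.up {C : Type} {σ : Nat → Tm C} (h : Rigid σ) : Rigid (Tm.up σ) := by
  intro i
  cases i with
  | zero => exact .inl ⟨0, rfl⟩
  | succ i =>
    rcases h i with ⟨m, e⟩ | ⟨m, n, e⟩
    · exact .inl ⟨m + 1, by rw [Tm.up_succ, e]; rfl⟩
    · exact .inr ⟨m + 1, n + 1, by rw [Tm.up_succ, e]; rfl⟩

theorem rigid_fsub {C : Type} : Rigid (fsub : Nat → Tm C) := by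
  intro i
  cases i with
  | zero => exact .inr ⟨1, 0, rfl⟩
  | succ m => exact .inl ⟨m + 2, rfl⟩

/-- `σ` has a left inverse up to reduction with oracle `Q`. -/
def LeftInv (S : CanSys B D) (Q : Tm S.C → Tm S.C → Prop) (σ : Nat → Tm S.C) : Prop :=
  ∃ σ' : Nat → Tm S.C, ∀ i, OSteps S Q ((σ i).bind σ') (.var i)

theorem LeftInv.up {Q : Tm S.C → Tm S.C → Prop} (hQ : SubstStable S Q) {σ : Nat → Tm S.C}
    (h : LeftInv S Q σ) : LeftInv S Q (Tm.up σ) := by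
  obtain ⟨σ', h⟩ := h
  refine ⟨Tm.up σ', fun i => ?_⟩
  cases i with
  | zero => exact .refl
  | succ i =>
    rw [Tm.up_succ, Tm.lift_bind_up]
    exact (h i).lift hQ

theorem leftInv_fsub (Q : Tm S.C → Tm S.C → Prop) : LeftInv S Q fsub := by
  refine ⟨Tm.scons (.var 0) (Tm.scons (S.Kt (.var 0)) fun m => .var (m + 1)), fun i => ?_⟩
  cases i with
  | zero => exact .single (.beta _ _)
  | succ m => exact .refl

theorem LeftInv.reflect {P Q : Tm S.C → Tm S.C → Prop} (hP : SubstStable S P)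
    (hQ : SubstStable S Q) (hPQ : ∀ t t' ρ, P t ρ → OStep S Q t t' → P t' ρ)
    {σ : Nat → Tm S.C} (h : LeftInv S Q σ) {r ρ : Tm S.C} (hr : P (r.bind σ) ρ) : P r ρ := by
  obtain ⟨σ', h⟩ := h
  have h1 := hP _ _ hr σ'
  rw [Tm.bind_bind] at h1
  have h2 := OSteps.bind_right hQ r h
  rw [Tm.bind_var] at h2
  exact h2.preserve hPQ h1

theorem Rigid.not_step {P : Tm S.C → Tm S.C → Prop} {σ : Nat → Tm S.C} (h : Rigid σ) (i : Nat)
    (s : Tm S.C) : ¬ OStep S P (σ i) s := by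
  intro hs
  rcases h i with ⟨m, e⟩ | ⟨m, n, e⟩ <;> rw [e] at hs
  · exact OStep.not_var hs
  · rcases hs.app_inv with ⟨_, e, -⟩ | ⟨_, _, _, -, hm, -⟩ | ⟨_, -, h⟩ | ⟨_, -, h⟩
    · cases e
    · exact canon_ne_var ⟨_, by simp, hm⟩ rfl
    · exact OStep.not_var h
    · exact OStep.not_var h

theorem Rigid.step_inv {P Q : Tm S.C → Tm S.C → Prop} (hP : SubstStable S P)
    (hQ : SubstStable S Q) (hPQ : ∀ t t' ρ, P t ρ → OStep S Q t t' → P t' ρ)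
    {σ : Nat → Tm S.C} (hσ : Rigid σ) (hi : LeftInv S Q σ) {q s : Tm S.C}
    (h : OStep S P (q.bind σ) s) : ∃ q', s = q'.bind σ ∧ OStep S P q q' := by
  induction q generalizing σ s with
  | var i => exact absurd h (hσ.not_step i s)
  | const c => exact absurd h OStep.not_const
  | app a b iha ihb =>
    rcases h.app_inv with ⟨t, e, rfl⟩ | ⟨τ1, τ2, ρ1, hτ, hm, hρ, hp, rfl⟩ | ⟨a', rfl, ha⟩ |
      ⟨b', rfl, hb⟩
    · cases a with
      | var i => rcases hσ i with ⟨m, e'⟩ | ⟨m, n, e'⟩ <;> rw [Tm.bind_var_apply, e'] at e <;> cases e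
      | const c => cases e
      | app _ _ => cases e
      | lam a =>
        cases e
        exact ⟨a.subst0 b, (Tm.subst0_bind a b σ).symm, .beta a b⟩
    · obtain ⟨c, e⟩ := const_of_mem_arr hτ hm
      cases a with
      | var i => rcases hσ i with ⟨m, e'⟩ | ⟨m, n, e'⟩ <;> rw [Tm.bind_var_apply, e'] at e <;> cases e
      | const c =>
        exact ⟨_, (Tm.bind_of_closed (closed_of_mem (cod_ne_omega hm) (F_mem hm hρ)) σ).symm,
          .crule hτ hm hρ (hi.reflect hP hQ hPQ hp)⟩
      | app _ _ => cases e
      | lam a => cases e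
    · obtain ⟨a0, rfl, h0⟩ := iha hσ hi ha
      exact ⟨.app a0 b, rfl, .appL b h0⟩
    · obtain ⟨b0, rfl, h0⟩ := ihb hσ hi hb
      exact ⟨.app a b0, rfl, .appR a h0⟩
  | lam a ih =>
    rcases h.lam_inv with e | ⟨t', rfl, ht⟩
    · have key (i : Nat) (u : Tm S.C) : Tm.up σ i ≠ .app u (.var 0) := by
        cases i with
        | zero => nofun
        | succ i =>
          rw [Tm.up_succ]
          rcases hσ i with ⟨m, e'⟩ | ⟨m, n, e'⟩ <;> rw [e'] <;> intro e <;> cases e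
      have key0 (i : Nat) (h0 : Tm.up σ i = .var 0) : i = 0 := by
        cases i with
        | zero => rfl
        | succ i =>
          rw [Tm.up_succ] at h0
          rcases hσ i with ⟨m, e'⟩ | ⟨m, n, e'⟩ <;> rw [e'] at h0 <;> cases h0
      cases a with
      | var i => exact absurd e (key i _)
      | const c => cases e
      | lam _ => cases e
      | app a1 a2 =>
        change Tm.app (a1.bind (Tm.up σ)) (a2.bind (Tm.up σ)) = _ at e
        simp only [Tm.app.injEq] at e
        obtain ⟨e1, e2⟩ := e
        have hv : a2 = .var 0 := by
          cases a2 with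
          | var i => rw [key0 i e2]
          | _ => cases e2
        obtain ⟨a1, rfl⟩ := Tm.exists_lift_of_not_occ (t := a1) fun h0 =>
          Tm.not_occ_zero_lift s (e1 ▸ Tm.occ_bind.2 ⟨0, h0, rfl⟩)
        rw [Tm.lift_bind_up] at e1
        rw [hv]
        exact ⟨a1, (Tm.lift_injective e1).symm, .eta a1⟩
    · obtain ⟨a0, rfl, h0⟩ := ih hσ.up (hi.up hQ) ht
      exact ⟨.lam a0, rfl, .lam h0⟩

end Extended

section Coherence

variable {S : CanSys B D} {α β : Ordinal.{0}}

/-- Preservation, uniqueness and commutation for the stages `α` and `β`. -/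
structure XGood (S : CanSys B D) (α β : Ordinal.{0}) : Prop where
  ty : ∀ t t' τ, XTy S (XLead S α) t τ → OStep S (XOracle S β) t t' → XTy S (XLead S α) t' τ
  succ : ∀ t t' ρ, XSucc S α t ρ → OStep S (XOracle S β) t t' → XSucc S α t' ρ
  tyUnique : ∀ t τ τ', XTy S (XLead S α) t τ → XTy S (XLead S β) t τ' → τ = τ'
  unique : ∀ t τ ρ ρ', τ ≠ .omega → ρ ∈ S.TT τ → ρ' ∈ S.TT τ → XSucc S α t ρ →
    XSucc S β t ρ' → ρ = ρ'
  comm : ∀ t u v, OSteps S (XOracle S α) t u → OSteps S (XOracle S β) t v →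
    ∃ w, OSteps S (XOracle S β) u w ∧ OSteps S (XOracle S α) v w

theorem XGood.ty_steps (H : XGood S α β) {t t' : Tm S.C} {τ : ETy B}
    (h : XTy S (XLead S α) t τ) (hs : OSteps S (XOracle S β) t t') : XTy S (XLead S α) t' τ := by
  induction hs with
  | refl => exact h
  | tail _ hs ih => exact H.ty _ _ _ ih hs

/-- `XGood` holds at all pairs of stages below `(α, β)`. -/
def XBelow (S : CanSys B D) (α β : Ordinal.{0}) : Prop :=
  ∀ γ ≤ α, ∀ δ ≤ β, γ < α ∨ δ < β → XGood S γ δ ∧ XGood S δ γ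

namespace XBelow

theorem symm (H : XBelow S α β) : XBelow S β α :=
  fun γ hγ δ hδ h => (H δ hδ γ hγ h.symm).symm

theorem mono (H : XBelow S α β) {α' β' : Ordinal.{0}} (hα : α' ≤ α) (hβ : β' ≤ β) :
    XBelow S α' β' :=
  fun γ hγ δ hδ h => H γ (hγ.trans hα) δ (hδ.trans hβ)
    (h.imp (fun h => h.trans_le hα) fun h => h.trans_le hβ)

theorem left (H : XBelow S α β) {γ : Ordinal.{0}} (hγ : γ < α) : XGood S γ β :=
  (H γ hγ.le β le_rfl (.inl hγ)).1

theorem right (H : XBelow S α β) {δ : Ordinal.{0}} (hδ : δ < β) : XGood S α δ :=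
  (H α le_rfl δ hδ.le (.inr hδ)).1

theorem lead_step (H : XBelow S α β) {t t' ρ : Tm S.C} (h : XLead S α t ρ)
    (hs : OStep S (XOracle S β) t t') : XLead S α t' ρ := by
  obtain ⟨γ, hγ, u, hu, hρ⟩ := h
  obtain ⟨w, h1, h2⟩ := (H.left hγ).comm t u t' hu (.single hs)
  exact ⟨γ, hγ, w, h2, h1.preserve (H.left hγ).succ hρ⟩

theorem lead_unique (H : XBelow S α β) {t : Tm S.C} {τ : ETy B} {ρ ρ' : Tm S.C} (hτ : τ ≠ .omega)
    (hρ : ρ ∈ S.TT τ) (hρ' : ρ' ∈ S.TT τ) (h : XLead S α t ρ) (h' : XLead S β t ρ') : ρ = ρ' := by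
  obtain ⟨γ, hγ, u, hu, h1⟩ := h
  obtain ⟨δ, hδ, v, hv, h2⟩ := h'
  obtain ⟨g1, g2⟩ := H γ hγ.le δ hδ.le (.inl hγ)
  obtain ⟨w, h3, h4⟩ := g1.comm t u v hu hv
  exact g1.unique w τ ρ ρ' hτ hρ hρ' (h3.preserve g1.succ h1) (h4.preserve g2.succ h2)

theorem oracle_step (H : XBelow S α β) {t t' ρ : Tm S.C} (h : XOracle S α t ρ)
    (hs : OStep S (XOracle S β) t t') : XOracle S α t' ρ := by
  rcases h with ⟨rfl, τ, hτ, hm⟩ | ⟨δ, hδ, h⟩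
  · exact absurd hs (OStep.not_of_mem hτ hm)
  · exact .inr ⟨δ, hδ, (H.left hδ).succ _ _ _ h hs⟩

theorem oracle_unique (H : XBelow S α β) {t : Tm S.C} {τ : ETy B} {ρ ρ' : Tm S.C}
    (hτ : τ ≠ .omega) (hρ : ρ ∈ S.TT τ) (hρ' : ρ' ∈ S.TT τ) (h : XOracle S α t ρ)
    (h' : XOracle S β t ρ') : ρ = ρ' := by
  have refl {ρ : Tm S.C} (hρ : ρ ∈ S.TT τ) : XSucc S 0 ρ ρ := by
    rw [xSucc_eq]
    exact .refl hτ hρ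
  rcases h with ⟨rfl, -⟩ | ⟨δ, hδ, h⟩ <;> rcases h' with ⟨e, -⟩ | ⟨δ', hδ', h'⟩
  · exact e
  · exact (H 0 zero_le δ' hδ'.le (.inr hδ')).1.unique _ τ _ _ hτ hρ hρ' (refl hρ) h'
  · subst e
    exact (H δ hδ.le 0 zero_le (.inl hδ)).1.unique _ τ _ _ hτ hρ hρ' h (refl hρ')
  · exact (H δ hδ.le δ' hδ'.le (.inl hδ)).1.unique _ τ _ _ hτ hρ hρ' h h'

theorem comm (hD : ∀ b, Nonempty (D b)) (H : XBelow S α β) {t u v : Tm S.C}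
    (hu : OSteps S (XOracle S α) t u) (hv : OSteps S (XOracle S β) t v) :
    ∃ w, OSteps S (XOracle S β) u w ∧ OSteps S (XOracle S α) v w :=
  OSteps.commute (XOracle.substStable α) (XOracle.substStable β) (XOracle.not_var hD α)
    (XOracle.not_var hD β) (fun _ _ _ _ hτ hρ hρ' => H.oracle_unique hτ hρ hρ')
    (fun _ _ _ => H.oracle_step) (fun _ _ _ => H.symm.oracle_step) hu hv

end XBelow

theorem OStep.xiLam_inv {P : Tm S.C → Tm S.C → Prop} (hP : SubstStable S P) {a s u : Tm S.C}
    (h : OStep S P (S.xiLam a s) u) : (s = .var 0 ∧ u = .app S.XiT a) ∨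
      (∃ a', u = S.xiLam a' s ∧ OStep S P a a') ∨ ∃ s', u = S.xiLam a s' ∧ OStep S P s s' := by
  rcases h.lam_inv with e | ⟨t, rfl, ht⟩
  · simp only [Tm.app.injEq] at e
    exact .inl ⟨e.2, Tm.lift_injective e.1.symm⟩
  · rcases ht.app_app_const_inv not_canon_Xi with ⟨a', rfl, ha⟩ | ⟨s', rfl, hs⟩
    · obtain ⟨a', rfl, h1⟩ := ha.of_lift hP
      exact .inr (.inl ⟨a', rfl, h1⟩)
    · exact .inr (.inr ⟨s', rfl, hs⟩)

theorem bind_fsub_eq_app_var {q s : Tm S.C} (h : q.bind fsub = .app s (.var 0)) : q = .var 0 := by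
  cases q with
  | var n =>
    cases n with
    | zero => rfl
    | succ n => cases h
  | app a b =>
    simp only [Tm.bind_app, Tm.app.injEq] at h
    cases b with
    | var n => cases n <;> cases h.2
    | _ => cases h.2
  | _ => cases h

theorem XTy.step {Ld P Q : Tm S.C → Tm S.C → Prop} (hP : SubstStable S P) (hQ : SubstStable S Q)
    (hPQ : ∀ t t' ρ, P t ρ → OStep S Q t t' → P t' ρ)
    (hLd : ∀ t t' ρ, Ld t ρ → OStep S P t t' → Ld t' ρ) {t t' : Tm S.C} {τ : ETy B}
    (h : XTy S Ld t τ) (hs : OStep S P t t') : XTy S Ld t' τ := by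
  induction h generalizing t' with
  | base b => exact absurd hs OStep.not_const
  | baseEta b =>
    rcases hs.lam_inv with e | ⟨u, rfl, hu⟩
    · simp only [Tm.app.injEq] at e
      rw [Tm.lift_eq_const e.1.symm]
      exact .base b
    · obtain ⟨v, -, hv⟩ := hu.app_const_inv (not_canon_A b)
      exact absurd hv OStep.not_var
  | prop =>
    rcases hs.lam_inv with e | ⟨u, rfl, hu⟩
    · simp only [Tm.app.injEq, reduceCtorEq, and_false] at e
    · obtain ⟨v, -, hv⟩ := hu.app_const_inv not_canon_L
      rcases hv.lam_inv with e | ⟨w, -, hw⟩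
      · cases e
      · exact absurd hw OStep.not_var
  | kTop h =>
    obtain ⟨u, rfl, hu⟩ := hs.K_inv hP
    exact .kTop (hLd _ _ _ h hu)
  | kBot h =>
    obtain ⟨u, rfl, hu⟩ := hs.K_inv hP
    exact .kBot (hLd _ _ _ h hu)
  | @func a q τ1 τ2 h1 h2 ih1 ih2 =>
    rcases hs.xiLam_inv hP with ⟨e, -⟩ | ⟨a', rfl, ha⟩ | ⟨s', rfl, hq⟩
    · cases e
    · exact .func (ih1 ha) h2
    · rcases hq.lam_inv with e | ⟨u, rfl, hu⟩
      · exact absurd (bind_fsub_eq_app_var e ▸ h2) XTy.not_id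
      · obtain ⟨q', rfl, hr⟩ := rigid_fsub.step_inv hP hQ hPQ (leftInv_fsub Q) hu
        exact .func h1 (ih2 (.lam hr))
  | funcEps s h ih =>
    rcases hs.xiLam_inv hP with ⟨-, rfl⟩ | ⟨a', rfl, ha⟩ | ⟨s', rfl, -⟩
    · exact .xiEps h
    · exact .funcEps s (ih ha)
    · exact .funcEps s' h
  | xiEps h ih =>
    obtain ⟨u, rfl, hu⟩ := hs.app_const_inv not_canon_Xi
    exact .xiEps (ih hu)

theorem XBelow.ty_step (H : XBelow S α β) {t t' : Tm S.C} {τ : ETy B}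
    (h : XTy S (XLead S α) t τ) (hs : OStep S (XOracle S β) t t') : XTy S (XLead S α) t' τ :=
  h.step (Ld := XLead S α) (XOracle.substStable β) (XOracle.substStable 0)
    (fun _ _ _ => (H.symm.mono le_rfl zero_le).oracle_step) (fun _ _ _ => H.lead_step) hs

theorem XBelow.succ_step (H : XBelow S α β) {t t' ρ : Tm S.C} (h : XSucc S α t ρ)
    (hs : OStep S (XOracle S β) t t') : XSucc S α t' ρ := by
  rw [xSucc_eq] at h ⊢
  cases h with
  | refl hτ hρ => exact absurd hs (OStep.not_of_mem hτ hρ)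
  | fn hρ hf => exact .fn hρ fun t1 h1 => H.lead_step (hf t1 h1) (.appL t1 hs)
  | topL t =>
    obtain ⟨u, rfl, -⟩ := hs.app_const_inv not_canon_L
    exact .topL u
  | topA b t =>
    obtain ⟨u, rfl, -⟩ := hs.app_const_inv (not_canon_A b)
    exact .topA b u
  | xiTop h1 h2 =>
    rcases hs.app_app_const_inv not_canon_Xi with ⟨a', rfl, ha⟩ | ⟨s', rfl, hs'⟩
    · exact .xiTop (H.ty_step h1 ha) h2
    · exact .xiTop h1 fun t ht => H.lead_step (h2 t ht) (.appL t hs')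
  | xiBot h1 ht hb =>
    rcases hs.app_app_const_inv not_canon_Xi with ⟨a', rfl, ha⟩ | ⟨s', rfl, hs'⟩
    · exact .xiBot (H.ty_step h1 ha) ht hb
    · exact .xiBot h1 ht (H.lead_step hb (.appL _ hs'))

theorem XVal.prop_inv {Ld : Tm S.C → Tm S.C → Prop} {t ρ : Tm S.C} (h : XVal S Ld t ρ)
    (hρ : ρ ∈ S.TT .o) :
    t = ρ ∨ (∃ s, t = .app S.LT s ∧ ρ = S.top) ∨ (∃ b s, t = .app (S.AT b) s ∧ ρ = S.top) ∨
      ∃ a s τ, t = .app (.app S.XiT a) s ∧ XTy S Ld a τ ∧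
        ((ρ = S.top ∧ ∀ u ∈ S.TT τ, Ld (.app s u) S.top) ∨
          (ρ = S.bot ∧ ∃ u ∈ S.TT τ, Ld (.app s u) S.bot)) := by
  cases h with
  | refl => exact .inl rfl
  | fn hf => exact absurd (type_unique (by simp) (by simp) hf hρ) (by simp)
  | topL s => exact .inr (.inl ⟨s, rfl, rfl⟩)
  | topA b s => exact .inr (.inr (.inl ⟨b, s, rfl, rfl⟩))
  | xiTop h1 h2 => exact .inr (.inr (.inr ⟨_, _, _, rfl, h1, .inl ⟨rfl, h2⟩⟩))
  | xiBot h1 ht hb => exact .inr (.inr (.inr ⟨_, _, _, rfl, h1, .inr ⟨rfl, _, ht, hb⟩⟩))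

theorem XBelow.lead_xi (H : XBelow S α β) {a s ρ : Tm S.C} {τ : ETy B} (hρ : ρ ∈ S.TT .o)
    (h : XLead S α (.app (.app S.XiT a) s) ρ) (ha : XTy S (XLead S β) a τ) :
    ∃ γ < α, ∃ s', OSteps S (XOracle S γ) s s' ∧
      ((ρ = S.top ∧ ∀ u ∈ S.TT τ, XLead S γ (.app s' u) S.top) ∨
        (ρ = S.bot ∧ ∃ u ∈ S.TT τ, XLead S γ (.app s' u) S.bot)) := by
  obtain ⟨γ, hγ, u, hu, h⟩ := h
  obtain ⟨a', s', rfl, h1, h2⟩ := hu.app_app_const_inv not_canon_Xi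
  rw [xSucc_eq] at h
  refine ⟨γ, hγ, s', h2, ?_⟩
  rcases h.prop_inv hρ with e | ⟨_, e, -⟩ | ⟨_, _, e, -⟩ | ⟨a0, s0, τ0, e, h3, h4⟩
  · exact absurd e.symm (canon_ne_app ⟨_, by simp, hρ⟩)
  · cases e
  · cases e
  · simp only [Tm.app.injEq] at e
    obtain ⟨⟨-, rfl⟩, rfl⟩ := e
    have ha' : XTy S (XLead S β) a' τ :=
      (H.symm.right hγ).ty_steps ha h1
    obtain rfl := (H.left hγ).tyUnique _ _ _ h3 ha'
    exact h4

theorem CanSys.Kt_ne_of_occ {t u : Tm S.C} (hu : u.Occ 0) : S.Kt t ≠ .lam u := by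
  intro e
  simp only [CanSys.Kt, Tm.lam.injEq] at e
  exact Tm.not_occ_zero_lift t (e ▸ hu)

theorem CanSys.Kt_inj {t u : Tm S.C} (h : S.Kt t = S.Kt u) : t = u := by
  simp only [CanSys.Kt, Tm.lam.injEq] at h
  exact Tm.lift_injective h

theorem CanSys.Kt_eq_xiLam {t a s : Tm S.C} (h : S.Kt t = S.xiLam a s) :
    ∃ s', t = .app (.app S.XiT a) s' ∧ s = s'.lift := by
  simp only [CanSys.Kt, CanSys.xiLam, Tm.lam.injEq] at h
  obtain ⟨u, s', rfl, h1, h2⟩ := Tm.lift_eq_app h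
  obtain rfl : .app S.XiT a = u := Tm.lift_injective h1
  exact ⟨s', rfl, h2⟩

theorem eq_Kt_of_lam_bind_fsub {q s : Tm S.C} (h : Tm.lam (q.bind fsub) = s.lift) :
    ∃ r, q = r.lift ∧ s = S.Kt r := by
  obtain ⟨s0, rfl, e⟩ := Tm.lift_eq_lam h.symm
  obtain ⟨r, rfl⟩ := Tm.exists_lift_of_not_occ (t := q) fun h0 => by
    have h1 : Tm.Occ 1 (q.bind fsub) := Tm.occ_bind.2 ⟨0, h0, .inl rfl⟩
    obtain ⟨m, -, h3⟩ := Tm.occ_bind.1 (e ▸ h1)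
    cases m with
    | zero => cases h3
    | succ m =>
      have h4 : 1 = m + 1 + 1 := h3
      omega
  refine ⟨r, rfl, Tm.lift_injective ?_⟩
  rw [← h, Tm.lift_bind]
  rw [Tm.lift_eq_bind (S.Kt r), CanSys.Kt_bind, CanSys.Kt, Tm.lift_eq_bind (r.bind _), Tm.bind_bind]
  rfl

/-- The type assigned to `K t` when the value of `t` is `⊤` or `⊥`. -/
theorem XBelow.k_type (hD : ∀ b, Nonempty (D b)) (H : XBelow S α β) {t ρ : Tm S.C} {τ : ETy B}
    (hρ : ρ ∈ S.TT .o) (h : XLead S α t ρ) (ht : XTy S (XLead S β) (S.Kt t) τ) :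
    (ρ = S.top → τ = .omega) ∧ (ρ = S.bot → τ = .eps) := by
  generalize e : S.Kt t = u at ht
  cases ht with
  | base b => cases e
  | baseEta b => exact absurd e (CanSys.Kt_ne_of_occ (.inr rfl))
  | prop => exact absurd e (CanSys.Kt_ne_of_occ (.inr rfl))
  | kTop h' =>
    obtain rfl := CanSys.Kt_inj e
    obtain rfl := H.lead_unique (by simp) hρ top_mem h h'
    exact ⟨fun _ => rfl, fun e => absurd e S.top_ne_bot⟩
  | kBot h' =>
    obtain rfl := CanSys.Kt_inj e
    obtain rfl := H.lead_unique (by simp) hρ bot_mem h h'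
    exact ⟨fun e => absurd e.symm S.top_ne_bot, fun _ => rfl⟩
  | @func a q τ1 τ2 h1 h2 =>
    obtain ⟨s, rfl, e'⟩ := CanSys.Kt_eq_xiLam e
    obtain ⟨r, rfl, rfl⟩ := eq_Kt_of_lam_bind_fsub (S := S) e'
    obtain ⟨γ, hγ, s', hs, h3⟩ := H.lead_xi hρ h h1
    obtain ⟨r', rfl, -⟩ := hs.K_inv (XOracle.substStable γ)
    have hr : XTy S (XLead S β) (S.Kt r') τ2 :=
      (H.symm.right hγ).ty_steps h2 hs
    have hk {u ρ : Tm S.C} (hu : XLead S γ (.app (S.Kt r') u) ρ) : XLead S γ r' ρ := by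
      refine (H.mono hγ.le zero_le).lead_step hu ?_
      have := OStep.beta (P := XOracle S 0) r'.lift u
      rwa [Tm.lift_subst0] at this
    by_cases hτ : τ1 = .eps
    · subst hτ
      rw [arrN_eps_left]
      refine ⟨fun _ => rfl, ?_⟩
      rintro rfl
      rcases h3 with ⟨e, -⟩ | ⟨-, u, hu, -⟩
      · exact absurd e.symm S.top_ne_bot
      · rw [S.TT_eps] at hu
        exact hu.elim
    · rcases h3 with ⟨rfl, h3⟩ | ⟨rfl, u, -, h3⟩
      · obtain ⟨u, hu⟩ := nonempty_of_isTp hD h1.isTp hτ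
        obtain rfl := (H.left hγ).tyUnique _ _ _ (.kTop (hk (h3 u hu))) hr
        exact ⟨fun _ => arrN_omega τ1, fun e => absurd e S.top_ne_bot⟩
      · obtain rfl := (H.left hγ).tyUnique _ _ _ (.kBot (hk h3)) hr
        exact ⟨fun e => absurd e.symm S.top_ne_bot, fun _ => arrN_eps_right hτ⟩
  | funcEps s h1 =>
    obtain ⟨s, rfl, -⟩ := CanSys.Kt_eq_xiLam e
    refine ⟨fun _ => rfl, ?_⟩
    rintro rfl
    obtain ⟨γ, hγ, s', -, ⟨e, -⟩ | ⟨-, u, hu, -⟩⟩ := H.lead_xi hρ h h1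
    · exact absurd e.symm S.top_ne_bot
    · rw [S.TT_eps] at hu
      exact hu.elim
  | xiEps _ => cases e

/-- An injective substitution whose values `x y` have a `y` that is not itself a value. -/
structure Separated {C : Type} (σ : Nat → Tm C) : Prop where
  rigid : Rigid σ
  inj : Function.Injective σ
  sep : ∀ i j m n, σ i = .app (.var m) (.var n) → σ j ≠ .var n

theorem Separated.up {C : Type} {σ : Nat → Tm C} (h : Separated σ) : Separated (Tm.up σ) where
  rigid := h.rigid.up
  inj i j e := by
    cases i with
    | zero =>
      cases j with
      | zero => rfl
      | succ j =>
        exact absurd (show Tm.Occ 0 (Tm.var 0 : Tm C) from rfl)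
          ((show Tm.var 0 = (σ j).lift from e) ▸ Tm.not_occ_zero_lift _)
    | succ i =>
      cases j with
      | zero =>
        exact absurd (show Tm.Occ 0 (Tm.var 0 : Tm C) from rfl)
          ((show (σ i).lift = Tm.var 0 from e) ▸ Tm.not_occ_zero_lift _)
      | succ j => rw [h.inj (Tm.lift_injective e)]
  sep i j m n e e' := by
    cases i with
    | zero => cases e
    | succ i =>
      rw [Tm.up_succ] at e
      rcases h.rigid i with ⟨m', hi⟩ | ⟨m', n', hi⟩ <;> rw [hi] at e <;> cases e
      cases j with
      | zero => cases e'
      | succ j =>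
        rw [Tm.up_succ] at e'
        exact h.sep i j m' n' hi (Tm.lift_injective e')

theorem separated_fsub {C : Type} : Separated (fsub : Nat → Tm C) where
  rigid := rigid_fsub
  inj i j e := by
    cases i <;> cases j <;> cases e <;> rfl
  sep i j m n e e' := by
    cases i <;> cases e
    cases j <;> cases e'

theorem Separated.bind_injective {C : Type} {σ : Nat → Tm C} (h : Separated σ) {q q' : Tm C}
    (e : q.bind σ = q'.bind σ) : q = q' := by
  have key {σ : Nat → Tm C} (h : Separated σ) {i : Nat} {a b : Tm C}
      (e : σ i = (Tm.app a b).bind σ) : False := by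
    rcases h.rigid i with ⟨m, hi⟩ | ⟨m, n, hi⟩
    · rw [hi] at e
      cases e
    · have hb := hi.symm.trans e
      simp only [Tm.bind_app, Tm.app.injEq] at hb
      cases b with
      | var j => exact h.sep i j m n hi hb.2.symm
      | _ => cases hb.2
  have key' {σ : Nat → Tm C} (h : Separated σ) {i : Nat} {u : Tm C}
      (e : σ i = u.bind σ) : u = .var i := by
    cases u with
    | var j => rw [h.inj e]
    | app a b => exact (key h e).elim
    | _ => rcases h.rigid i with ⟨m, hi⟩ | ⟨m, n, hi⟩ <;> rw [hi] at e <;> cases e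
  induction q generalizing σ q' with
  | var i => exact (key' h e).symm
  | const c =>
    cases q' with
    | var i => exact key' h e.symm
    | const c' => exact e
    | _ => cases e
  | app a b iha ihb =>
    cases q' with
    | var i => exact key' h e.symm
    | app a' b' =>
      simp only [Tm.bind_app, Tm.app.injEq] at e
      rw [iha h e.1, ihb h e.2]
    | _ => cases e
  | lam a ih =>
    cases q' with
    | var i => exact key' h e.symm
    | lam a' =>
      simp only [Tm.bind_lam, Tm.lam.injEq] at e
      rw [ih h.up e]
    | _ => cases e

theorem XBelow.ty_unique (hD : ∀ b, Nonempty (D b)) (H : XBelow S α β) {t : Tm S.C}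
    {τ τ' : ETy B} (h : XTy S (XLead S α) t τ) (h' : XTy S (XLead S β) t τ') : τ = τ' := by
  induction h generalizing τ' with
  | kTop h => exact ((H.k_type hD top_mem h h').1 rfl).symm
  | kBot h => exact ((H.k_type hD bot_mem h h').2 rfl).symm
  | base b =>
    generalize e : S.AT b = u at h'
    cases h' with
    | base b' =>
      simp only [CanSys.AT, Tm.const.injEq] at e
      rw [S.hAinj e]
    | _ => cases e
  | baseEta b =>
    generalize e : Tm.lam (.app (S.AT b) (.var 0)) = u at h'
    cases h' with
    | baseEta b' =>
      simp only [CanSys.AT, Tm.lam.injEq, Tm.app.injEq, Tm.const.injEq, and_true] at e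
      rw [S.hAinj e]
    | kTop _ | kBot _ => exact absurd e.symm (CanSys.Kt_ne_of_occ (.inr rfl))
    | prop =>
      simp only [CanSys.Hterm, Tm.lam.injEq, Tm.app.injEq, reduceCtorEq, and_false] at e
    | _ => cases e
  | prop =>
    generalize e : S.Hterm = u at h'
    cases h' with
    | prop => rfl
    | kTop _ | kBot _ => exact absurd e.symm (CanSys.Kt_ne_of_occ (.inr rfl))
    | baseEta b' =>
      rw [CanSys.Hterm, Tm.lam.injEq, Tm.app.injEq] at e
      cases e.2
    | _ => cases e
  | @func a q τ1 τ2 h1 h2 ih1 ih2 =>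
    generalize e : S.xiLam a (.lam (q.bind fsub)) = u at h'
    cases h' with
    | kTop h' => exact (H.symm.k_type hD top_mem h' (e ▸ h1.func h2)).1 rfl
    | kBot h' => exact (H.symm.k_type hD bot_mem h' (e ▸ h1.func h2)).2 rfl
    | func h1' h2' =>
      obtain ⟨rfl, hq⟩ := CanSys.xiLam_inj e
      obtain rfl := separated_fsub.bind_injective (Tm.lam.inj hq)
      rw [ih1 h1', ih2 h2']
    | funcEps s h1' =>
      obtain ⟨rfl, -⟩ := CanSys.xiLam_inj e
      rw [ih1 h1', arrN_eps_left]
    | _ => cases e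
  | @funcEps a s h1 ih1 =>
    generalize e : S.xiLam a s = u at h'
    cases h' with
    | kTop h' => exact (H.symm.k_type hD top_mem h' (e ▸ h1.funcEps s)).1 rfl
    | kBot h' => exact (H.symm.k_type hD bot_mem h' (e ▸ h1.funcEps s)).2 rfl
    | func h1' h2' =>
      obtain ⟨rfl, -⟩ := CanSys.xiLam_inj e
      rw [← ih1 h1', arrN_eps_left]
    | funcEps _ _ => rfl
    | _ => cases e
  | @xiEps a h1 ih1 =>
    generalize e : Tm.app S.XiT a = u at h'
    cases h' with
    | xiEps _ => rfl
    | _ => cases e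

theorem app_mem_step {τ1 τ2 : ETy B} {ρ t : Tm S.C} (hρ : ρ ∈ S.TT (.arr τ1 τ2))
    (ht : t ∈ S.TT τ1) (γ : Ordinal.{0}) :
    OStep S (XOracle S γ) (.app ρ t) (S.F τ1 τ2 ρ t) := by
  by_cases hτ : τ1 = .omega
  · subst hτ
    have h1 := (isT1_of_mem (by simp) hρ).arr_right
    rw [S.TT_omega_arr τ2 h1] at hρ
    obtain ⟨ρ0, h0, rfl⟩ := hρ
    rw [S.F_omega τ2 ρ0 h0]
    have := OStep.beta (P := XOracle S γ) ρ0 t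
    rwa [Tm.subst0_eq, Tm.bind_of_closed (closed_of_mem h1.ne_omega h0)] at this
  · exact .crule hτ hρ ht (.inl ⟨rfl, τ1, hτ, ht⟩)

theorem XBelow.succ_unique_of_refl (H : XBelow S α β) {τ1 τ2 : ETy B} {ρ ρ' : Tm S.C}
    (hρ : ρ ∈ S.TT (.arr τ1 τ2)) (hρ' : ρ' ∈ S.TT (.arr τ1 τ2))
    (h : ∀ t ∈ S.TT τ1, XLead S β (.app ρ t) (S.F τ1 τ2 ρ' t)) : ρ = ρ' := by
  refine arr_ext hρ hρ' fun t ht => ?_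
  have hm := F_mem hρ ht
  obtain ⟨γ, hγ, u, hu, hs⟩ := (H.symm.mono le_rfl zero_le).lead_step (h t ht) (app_mem_step hρ ht 0)
  obtain rfl := OStep.steps_of_mem (cod_ne_omega hρ) hm hu
  refine (H 0 zero_le γ hγ.le (.inr hγ)).1.unique _ τ2 _ _ (cod_ne_omega hρ) hm (F_mem hρ' ht) ?_ hs
  rw [xSucc_eq]
  exact .refl (cod_ne_omega hρ) hm

theorem XBelow.not_top_bot (hD : ∀ b, Nonempty (D b)) (H : XBelow S α β) {t : Tm S.C}
    (h : XSucc S α t S.top) (h' : XSucc S β t S.bot) : False := by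
  rw [xSucc_eq] at h h'
  rcases h'.prop_inv bot_mem with rfl | ⟨_, -, e⟩ | ⟨_, _, -, e⟩ |
    ⟨a, s, τ, rfl, h1, ⟨e, -⟩ | ⟨-, u, hu, h2⟩⟩
  · rcases h.prop_inv top_mem with e | ⟨s, e, -⟩ | ⟨b, s, e, -⟩ | ⟨a, s, τ, e, -⟩
    · exact S.top_ne_bot e.symm
    all_goals exact canon_ne_app ⟨_, by simp, bot_mem⟩ e
  · exact S.top_ne_bot e.symm
  · exact S.top_ne_bot e.symm
  · exact S.top_ne_bot e.symm
  · rcases h.prop_inv top_mem with e | ⟨s', e, -⟩ | ⟨b, s', e, -⟩ |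
      ⟨a', s', τ', e, h3, ⟨-, h4⟩ | ⟨e', -⟩⟩
    · exact canon_ne_app ⟨_, by simp, top_mem⟩ e.symm
    · cases e
    · cases e
    · simp only [Tm.app.injEq, true_and] at e
      obtain ⟨rfl, rfl⟩ := e
      obtain rfl := H.ty_unique hD h3 h1
      exact S.top_ne_bot (H.lead_unique (by simp) top_mem bot_mem (h4 u hu) h2)
    · exact S.top_ne_bot e'

theorem XBelow.succ_unique (hD : ∀ b, Nonempty (D b)) (H : XBelow S α β)
    {t ρ ρ' : Tm S.C} {τ : ETy B} (hτ : τ ≠ .omega) (hρ : ρ ∈ S.TT τ) (hρ' : ρ' ∈ S.TT τ)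
    (h : XSucc S α t ρ) (h' : XSucc S β t ρ') : ρ = ρ' := by
  by_cases ho : τ = .o
  · subst ho
    rw [S.TT_o] at hρ hρ'
    rcases hρ with rfl | rfl <;> rcases hρ' with rfl | rfl
    · rfl
    · exact (H.not_top_bot hD h h').elim
    · exact (H.symm.not_top_bot hD h' h).elim
    · rfl
  have inv {γ : Ordinal.{0}} {t ρ : Tm S.C} (hρ : ρ ∈ S.TT τ) (h : XSucc S γ t ρ) :
      t = ρ ∨ ∃ τ1 τ2, τ = .arr τ1 τ2 ∧ ∀ u ∈ S.TT τ1, XLead S γ (.app t u) (S.F τ1 τ2 ρ u) := by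
    rw [xSucc_eq] at h
    cases h with
    | refl => exact .inl rfl
    | fn hf h => exact .inr ⟨_, _, type_unique hτ (by simp) hρ hf, h⟩
    | topL | topA | xiTop => exact absurd (type_unique hτ (by simp) hρ top_mem) ho
    | xiBot => exact absurd (type_unique hτ (by simp) hρ bot_mem) ho
  rcases inv hρ h with rfl | ⟨τ1, τ2, rfl, hf⟩ <;> rcases inv hρ' h' with e | ⟨τ1', τ2', e, hf'⟩
  · exact e
  · subst e
    exact H.succ_unique_of_refl hρ hρ' hf'
  · subst e
    exact (H.symm.succ_unique_of_refl hρ' hρ hf).symm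
  · simp only [ETy.arr.injEq] at e
    obtain ⟨rfl, rfl⟩ := e
    exact arr_ext hρ hρ' fun u hu => H.lead_unique (cod_ne_omega hρ) (F_mem hρ hu) (F_mem hρ' hu)
      (hf u hu) (hf' u hu)

theorem XBelow.good (hD : ∀ b, Nonempty (D b)) (H : XBelow S α β) : XGood S α β where
  ty _ _ _ := H.ty_step
  succ _ _ _ := H.succ_step
  tyUnique _ _ _ := H.ty_unique hD
  unique _ _ _ _ := H.succ_unique hD
  comm _ _ _ := H.comm hD

theorem xBelow (hD : ∀ b, Nonempty (D b)) (α β : Ordinal.{0}) : XBelow S α β := by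
  induction α using WellFoundedLT.induction generalizing β with
  | _ α ihα =>
  induction β using WellFoundedLT.induction with
  | _ β ihβ =>
  intro γ hγ δ hδ h
  have key : XBelow S γ δ := by
    rcases hγ.lt_or_eq with hγ | rfl
    · exact ihα γ hγ δ
    · exact ihβ δ (h.resolve_left (lt_irrefl _))
  exact ⟨key.good hD, key.symm.good hD⟩

theorem xGood (hD : ∀ b, Nonempty (D b)) (α β : Ordinal.{0}) : XGood S α β :=
  (xBelow hD α β).good hD

end Coherence

/-! ### Basic properties of the construction -/

section Construction

variable {S : CanSys B D}

/-- The rules `c t → F(c)(ρ)` available at stage `α`. -/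
def SuccLt (S : CanSys B D) (α : Ordinal.{0}) (t ρ : Tm S.C) : Prop := ∃ γ < α, Succ S γ t ρ

theorem Step.oStep {α : Ordinal.{0}} {t t' : Tm S.C} (h : Step S α t t') :
    OStep S (SuccLt S α) t t' :=
  match h with
  | .beta _ t s => .beta t s
  | .eta _ t => .eta t
  | .crule hγ h1 hc hρ1 hs => .crule h1 hc hρ1 ⟨_, hγ, hs⟩
  | .appL s h => .appL s h.oStep
  | .appR t h => .appR t h.oStep
  | .lam h => .lam h.oStep

theorem OStep.step {α : Ordinal.{0}} {t t' : Tm S.C} (h : OStep S (SuccLt S α) t t') :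
    Step S α t t' := by
  induction h with
  | beta t s => exact .beta α t s
  | eta t => exact .eta α t
  | crule h1 hc hρ1 hs =>
    obtain ⟨γ, hγ, hs⟩ := hs
    exact .crule hγ h1 hc hρ1 hs
  | appL s _ ih => exact .appL s ih
  | appR t _ ih => exact .appR t ih
  | lam _ ih => exact .lam ih

theorem Steps.oSteps {α : Ordinal.{0}} {t t' : Tm S.C} (h : Steps S α t t') :
    OSteps S (SuccLt S α) t t' :=
  match h with
  | .refl _ _ => .refl
  | .tail h hs => h.oSteps.tail hs.oStep

theorem OSteps.steps {α : Ordinal.{0}} {t t' : Tm S.C} (h : OSteps S (SuccLt S α) t t') :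
    Steps S α t t' := by
  induction h with
  | refl => exact .refl α _
  | tail _ hs ih => exact .tail ih hs.step

theorem leadLt_iff {α : Ordinal.{0}} {t ρ : Tm S.C} : LeadLt S α t ρ ↔
    ∃ γ < α, ∃ t', OSteps S (SuccLt S γ) t t' ∧ Succ S γ t' ρ := by
  constructor
  · rintro ⟨hγ, ⟨h1, h2⟩⟩
    exact ⟨_, hγ, _, h1.oSteps, h2⟩
  · rintro ⟨γ, hγ, t', h1, h2⟩
    exact .mk hγ (.mk h1.steps h2)

theorem LeadLt.mono {α β : Ordinal.{0}} (h : α ≤ β) {t ρ : Tm S.C} (ht : LeadLt S α t ρ) :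
    LeadLt S β t ρ := by
  obtain ⟨hγ, ht⟩ := ht
  exact .mk (hγ.trans_le h) ht

theorem Sim.mono {α β : Ordinal.{0}} (h : α ≤ β) {t : Tm S.C} {τ : ETy B} (ht : Sim S α t τ) :
    Sim S β t τ := by
  cases ht with
  | ofA _ b => exact .ofA β b
  | ofH => exact .ofH β
  | ofKom ht => exact .ofKom (ht.mono h)
  | ofKeps ht => exact .ofKeps (ht.mono h)
  | ofF h1 h2 s1 s2 => exact .ofF (h1.trans_le h) (h2.trans_le h) s1 s2
  | ofFom hγ s => exact .ofFom (hγ.trans_le h) s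

theorem Succ.mono {α β : Ordinal.{0}} (h : α ≤ β) {t ρ : Tm S.C} (ht : Succ S α t ρ) :
    Succ S β t ρ := by
  cases ht with
  | refl hτ hρ => exact .refl hτ hρ β
  | fn hρ ht => exact .fn hρ fun t1 h1 => (ht t1 h1).mono h
  | topLA _ b => exact .topLA β b
  | topLH => exact .topLH β
  | topA hc => exact .topA hc β
  | topH hc => exact .topH hc β
  | xiTop hα h1 h2 => exact .xiTop (hα.trans_le h) (h1.mono h) fun t3 h3 => (h2 t3 h3).mono h
  | xiHTop hα h1 h2 => exact .xiHTop (hα.trans_le h) (h1.mono h) fun t3 h3 => (h2 t3 h3).mono h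
  | flTopEps hα h1 => exact .flTopEps (hα.trans_le h) (h1.mono h)
  | flTop hα hτ h1 h2 => exact .flTop (hα.trans_le h) hτ (h1.mono h) (h2.mono h)
  | hiTop hα h1 => exact .hiTop (hα.trans_le h) (h1.mono h)
  | xiBot hα hγ hH h1 h3 hb =>
    exact .xiBot (hα.trans_le h) (hγ.trans_le h) hH (h1.mono h) h3 (hb.mono h)

theorem stepR_iff {t t' : Tm S.C} : StepR S t t' ↔ OStep S (SuccS S) t t' := by
  constructor
  · rintro ⟨α, h⟩
    exact h.oStep.mono fun _ _ ⟨γ, _, h⟩ => ⟨γ, h⟩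
  · intro h
    suffices ∃ α, OStep S (SuccLt S α) t t' from this.imp fun _ h => h.step
    induction h with
    | beta t s => exact ⟨0, .beta t s⟩
    | eta t => exact ⟨0, .eta t⟩
    | crule h1 hc hρ1 hs =>
      obtain ⟨γ, hs⟩ := hs
      exact ⟨Order.succ γ, .crule h1 hc hρ1 ⟨γ, Order.lt_succ γ, hs⟩⟩
    | appL s _ ih => exact ih.imp fun _ h => .appL s h
    | appR t _ ih => exact ih.imp fun _ h => .appR t h
    | lam _ ih => exact ih.imp fun _ h => .lam h

theorem leadR_iff {t ρ : Tm S.C} :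
    LeadR S t ρ ↔ ∃ t', OSteps S (SuccS S) t t' ∧ SuccS S t' ρ := by
  have : StepR S = OStep S (SuccS S) := by
    ext t t'
    exact stepR_iff
  rw [LeadR, StepsR, this]

theorem LeadR.of_steps {t t' ρ : Tm S.C} (h : LeadR S t' ρ) (hs : OSteps S (SuccS S) t t') :
    LeadR S t ρ := by
  rw [leadR_iff] at h ⊢
  obtain ⟨u, h1, h2⟩ := h
  exact ⟨u, hs.trans h1, h2⟩

theorem Succ.leadR {α : Ordinal.{0}} {t ρ : Tm S.C} (h : Succ S α t ρ) : LeadR S t ρ :=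
  ⟨t, .refl, α, h⟩

theorem LeadLt.leadR {α : Ordinal.{0}} {t ρ : Tm S.C} (h : LeadLt S α t ρ) : LeadR S t ρ := by
  obtain ⟨γ, -, t', h1, h2⟩ := leadLt_iff.1 h
  exact h2.leadR.of_steps (h1.mono fun _ _ ⟨δ, _, h⟩ => ⟨δ, h⟩)

theorem SuccLt.mono {α β : Ordinal.{0}} (h : α ≤ β) (t ρ : Tm S.C) (ht : SuccLt S α t ρ) :
    SuccLt S β t ρ := by
  obtain ⟨γ, hγ, ht⟩ := ht
  exact ⟨γ, hγ.trans_le h, ht⟩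

theorem exists_oSteps {t t' : Tm S.C} (h : OSteps S (SuccS S) t t') :
    ∃ α, OSteps S (SuccLt S α) t t' := by
  induction h with
  | refl => exact ⟨0, .refl⟩
  | tail _ hs ih =>
    obtain ⟨α, h1⟩ := ih
    obtain ⟨β, h2⟩ := stepR_iff.2 hs
    exact ⟨max α β, (h1.mono (SuccLt.mono (le_max_left α β))).tail
      (h2.oStep.mono (SuccLt.mono (le_max_right α β)))⟩

theorem LeadR.exists_leadLt {t ρ : Tm S.C} (h : LeadR S t ρ) : ∃ α, LeadLt S α t ρ := by
  obtain ⟨t', h1, β, h2⟩ := leadR_iff.1 h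
  obtain ⟨α, h1⟩ := exists_oSteps h1
  exact ⟨Order.succ (max α β), leadLt_iff.2 ⟨max α β, Order.lt_succ _, t',
    h1.mono (SuccLt.mono (le_max_left α β)), h2.mono (le_max_right α β)⟩⟩

/-- The stages at which a family of terms reaches its values are bounded. -/
theorem exists_leadLt_forall {A : Set (Tm S.C)} {f g : Tm S.C → Tm S.C}
    (h : ∀ t ∈ A, LeadR S (f t) (g t)) : ∃ α, ∀ t ∈ A, LeadLt S α (f t) (g t) := by
  choose a ha using fun t : A => (h t t.2).exists_leadLt
  exact ⟨⨆ t, a t, fun t ht => (ha ⟨t, ht⟩).mono (Ordinal.le_iSup a ⟨t, ht⟩)⟩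

/-! #### The terms `F t₁ t₂` -/

/-- The body of the abstraction `λz. t z`, where `t` is contracted if it is an abstraction. -/
def Tm.body {C : Type} : Tm C → Tm C
  | .lam q => q
  | t => .app t.lift (.var 0)

theorem Tm.eq_lam_or_body_eq {C : Type} (t : Tm C) :
    (∃ q, t = .lam q) ∨ t.body = .app t.lift (.var 0) := by
  cases t with
  | lam q => exact .inl ⟨q, rfl⟩
  | _ => exact .inr rfl

theorem Tm.lam_body_bind (P : Tm S.C → Tm S.C → Prop) (t : Tm S.C) (σ : Nat → Tm S.C) :
    OSteps S P (.lam (t.body.bind (Tm.up σ))) (t.bind σ) := by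
  rcases t.eq_lam_or_body_eq with ⟨q, rfl⟩ | h
  · exact .refl
  · rw [h, Tm.bind_app, Tm.lift_bind_up]
    exact .single (.eta _)

theorem Tm.app_body (P : Tm S.C → Tm S.C → Prop) (t s : Tm S.C) :
    OSteps S P (.app t s) (t.body.subst0 s) := by
  rcases t.eq_lam_or_body_eq with ⟨q, rfl⟩ | h
  · exact .single (.beta q s)
  · rw [h, Tm.subst0_eq, Tm.bind_app, ← Tm.subst0_eq, Tm.lift_subst0]
    exact .refl

theorem Tm.eq_Kt_of_body {t r : Tm S.C} (h : t.body = r.lift) : t = S.Kt r := by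
  rcases t.eq_lam_or_body_eq with ⟨q, rfl⟩ | h'
  · rw [CanSys.Kt, ← h, Tm.body]
  · exact absurd (show Tm.Occ 0 (.app t.lift (.var 0)) from .inr rfl)
      ((h'.symm.trans h) ▸ Tm.not_occ_zero_lift r)

theorem Ft_eq (a b : Tm S.C) : S.Ft a b = S.xiLam a (.lam (b.body.bind fsub)) := by
  have key (t : Tm S.C) : t.lift.lift = t.lift.bind fsub := by
    rw [Tm.lift_eq_bind t.lift, Tm.lift_bind, Tm.lift_bind]
    rfl
  cases b with
  | lam q => rfl
  | _ =>
    simp only [Tm.body, Tm.bind_app, ← key]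
    rfl

theorem Ft_bind (a b : Tm S.C) (σ : Nat → Tm S.C) :
    (S.Ft a b).bind σ = S.Ft (a.bind σ) (.lam (b.body.bind (Tm.up σ))) := by
  rw [Ft_eq, Ft_eq, CanSys.xiLam_bind, Tm.bind_lam, fsub_bind]
  rfl

theorem Ht_bind (t : Tm S.C) (σ : Nat → Tm S.C) : (S.Ht t).bind σ = S.Ht (t.bind σ) := by
  rw [CanSys.Ht, Tm.bind_app, CanSys.Kt_bind]
  rfl

theorem Sim.eq_AT_or_lam {α : Ordinal.{0}} {t : Tm S.C} {τ : ETy B} (h : Sim S α t τ) :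
    (∃ b, t = S.AT b ∧ τ = .base b) ∨ ∃ q, t = .lam q := by
  cases h with
  | ofA _ b => exact .inl ⟨b, rfl, rfl⟩
  | _ => exact .inr ⟨_, rfl⟩

/-! #### Substitution -/

theorem succ_sim_bind (α : Ordinal.{0}) : SubstStable S (Succ S α) ∧
    ∀ (t : Tm S.C) (τ : ETy B), Sim S α t τ → ∀ σ : Nat → Tm S.C, Sim S α (t.bind σ) τ := by
  induction α using WellFoundedLT.induction with
  | _ α ih =>
  have lead : SubstStable S (LeadLt S α) := by
    intro t ρ h σ
    obtain ⟨γ, hγ, t', h1, h2⟩ := leadLt_iff.1 h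
    refine leadLt_iff.2 ⟨γ, hγ, t'.bind σ, h1.bind ?_ σ, (ih γ hγ).1 _ _ h2 σ⟩
    rintro t ρ ⟨δ, hδ, h⟩ σ
    exact ⟨δ, hδ, (ih δ (hδ.trans hγ)).1 _ _ h σ⟩
  have leadH : SubstStable S fun t ρ => LeadLt S α (S.Ht t) ρ := by
    intro t ρ h σ
    have := lead _ _ h σ
    rwa [Ht_bind] at this
  have sim (t : Tm S.C) (τ : ETy B) (h : Sim S α t τ) (σ : Nat → Tm S.C) :
      Sim S α (t.bind σ) τ := by
    cases h with
    | ofA _ b => exact .ofA α b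
    | ofH => exact .ofH α
    | ofKom h => exact S.Kt_bind _ σ ▸ .ofKom (lead _ _ h σ)
    | ofKeps h => exact S.Kt_bind _ σ ▸ .ofKeps (lead _ _ h σ)
    | @ofF _ γ1 γ2 hγ1 hγ2 a b τ1 τ2 h1 h2 =>
      have h1 := (ih γ1 hγ1).2 _ _ h1 σ
      rcases h2.eq_AT_or_lam with ⟨c, rfl, rfl⟩ | ⟨q, rfl⟩
      · have e : (S.Ft a (S.AT c)).bind σ = S.Ft (a.bind σ) (S.AT c) := by
          rw [Ft_bind, Ft_eq, Ft_eq]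
          rfl
        exact e ▸ .ofF hγ1 hγ2 h1 h2
      · exact Ft_bind (S := S) _ _ σ ▸ .ofF hγ1 hγ2 h1 ((ih γ2 hγ2).2 _ _ h2 σ)
    | ofFom hγ h => exact Ft_bind (S := S) _ _ σ ▸ .ofFom hγ ((ih _ hγ).2 _ _ h σ)
  refine ⟨fun t ρ h σ => ?_, sim⟩
  cases h with
  | refl hτ hρ =>
    rw [Tm.bind_of_closed (closed_of_mem hτ hρ)]
    exact .refl hτ hρ α
  | fn hρ hf =>
    refine .fn hρ (lead.bind_fun ?_ hf σ)
    rintro rfl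
    exact F_omega_const hρ
  | topLA _ b => exact .topLA α b
  | topLH => exact .topLH α
  | topA hc =>
    rw [Tm.bind_app, Tm.bind_of_closed (closed_of_mem (by simp) hc)]
    exact .topA hc α
  | topH hc =>
    refine Ht_bind (S := S) _ σ ▸ .topH ?_ α
    rcases hc with rfl | rfl
    · exact .inl (Tm.bind_of_closed (closed_of_mem (by simp) top_mem) σ)
    · exact .inr (Tm.bind_of_closed (closed_of_mem (by simp) bot_mem) σ)
  | xiTop hα h1 h2 =>
    exact .xiTop hα (sim _ _ h1 σ) (lead.bind_fun (fun _ _ _ => rfl) h2 σ)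
  | xiHTop hα h1 h2 =>
    exact Ht_bind (S := S) _ σ ▸ .xiHTop hα (sim _ _ h1 σ)
      (leadH.bind_fun (fun _ _ _ => rfl) h2 σ)
  | flTopEps hα h1 =>
    rw [Tm.bind_app, Ft_bind]
    exact .flTopEps hα (sim _ _ h1 σ)
  | @flTop _ hα _ b _ hτ h1 h2 =>
    rw [Tm.bind_app, Ft_bind]
    refine .flTop hα hτ (sim _ _ h1 σ) ?_
    obtain ⟨γ, hγ, t', h3, h4⟩ := leadLt_iff.1 (lead _ _ h2 σ)
    exact leadLt_iff.2 ⟨γ, hγ, t', (OSteps.appR _ (Tm.lam_body_bind _ b σ)).trans h3, h4⟩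
  | hiTop hα h => exact Ht_bind (S := S) _ σ ▸ .hiTop hα (lead _ _ h σ)
  | xiBot hα hγ hH h1 h3 hb =>
    have hH := (ih _ hγ).1 _ _ hH σ
    rw [Ht_bind] at hH
    exact .xiBot hα hγ hH (sim _ _ h1 σ) (mem_bind h3 σ) (lead _ _ hb σ)

theorem SuccS.substStable : SubstStable S (SuccS S) := by
  rintro t ρ ⟨α, h⟩ σ
  exact ⟨α, (succ_sim_bind α).1 _ _ h σ⟩

theorem LeadR.bind {t ρ : Tm S.C} (h : LeadR S t ρ) (σ : Nat → Tm S.C) :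
    LeadR S (t.bind σ) ρ := by
  rw [leadR_iff] at h ⊢
  obtain ⟨u, h1, h2⟩ := h
  exact ⟨u.bind σ, h1.bind SuccS.substStable σ, SuccS.substStable _ _ h2 σ⟩

/-! #### Embedding into the extended system -/

mutual

theorem Succ.xSucc {α : Ordinal.{0}} {t ρ : Tm S.C} (h : Succ S α t ρ) : XSucc S α t ρ := by
  rw [xSucc_eq]
  match h with
  | .refl hτ hρ _ => exact .refl hτ hρ
  | .fn hρ h => exact .fn hρ fun t1 h1 => (h t1 h1).xLead
  | .topLA _ _ | .topLH _ | .topH _ _ | .xiHTop _ _ _ | .flTopEps _ _ | .flTop _ _ _ _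
  | .hiTop _ _ => exact .topL _
  | .topA _ _ => exact .topA _ _
  | .xiTop _ h1 h2 => exact .xiTop h1.xTy fun t3 h3 => (h2 t3 h3).xLead
  | .xiBot _ _ _ h1 h3 hb => exact .xiBot h1.xTy h3 hb.xLead

theorem LeadLt.xLead {α : Ordinal.{0}} {t ρ : Tm S.C} (h : LeadLt S α t ρ) : XLead S α t ρ :=
  match h with
  | .mk hγ (.mk h1 h2) => ⟨_, hγ, _, h1.xSteps, h2.xSucc⟩

theorem Steps.xSteps {α : Ordinal.{0}} {t t' : Tm S.C} (h : Steps S α t t') :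
    OSteps S (XOracle S α) t t' :=
  match h with
  | .refl _ _ => .refl
  | .tail h hs => h.xSteps.tail hs.xStep

theorem Step.xStep {α : Ordinal.{0}} {t t' : Tm S.C} (h : Step S α t t') :
    OStep S (XOracle S α) t t' :=
  match h with
  | .beta _ t s => .beta t s
  | .eta _ t => .eta t
  | .crule hγ h1 hc hρ1 hs => .crule h1 hc hρ1 (.inr ⟨_, hγ, hs.xSucc⟩)
  | .appL s h => .appL s h.xStep
  | .appR t h => .appR t h.xStep
  | .lam h => .lam h.xStep

theorem Sim.xTy {α : Ordinal.{0}} {t : Tm S.C} {τ : ETy B} (h : Sim S α t τ) :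
    XTy S (XLead S α) t τ := by
  match h with
  | .ofA _ b => exact .base b
  | .ofH _ => exact .prop
  | .ofKom h => exact .kTop h.xLead
  | .ofKeps h => exact .kBot h.xLead
  | .ofF hγ1 hγ2 h1 h2 =>
    have h3 := h1.xTy.mono fun _ _ => XLead.mono hγ1.le
    have h4 := h2.xTy.mono fun _ _ => XLead.mono hγ2.le
    rw [Ft_eq]
    refine .func h3 ?_
    rcases h2.eq_AT_or_lam with ⟨c, rfl, rfl⟩ | ⟨q, rfl⟩
    · exact .baseEta c
    · exact h4
  | .ofFom hγ h1 =>
    have h3 := h1.xTy.mono fun _ _ => XLead.mono hγ.le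
    rw [Ft_eq]
    exact .funcEps _ h3

end

theorem Sim.type_unique_of_steps (hD : ∀ b, Nonempty (D b)) {α β : Ordinal.{0}} {t t' : Tm S.C}
    {τ τ' : ETy B} (h : Sim S α t τ) (hs : OSteps S (SuccS S) t t') (h' : Sim S β t' τ') :
    τ = τ' := by
  obtain ⟨γ, hs⟩ := exists_oSteps hs
  exact (xGood hD α β).tyUnique _ _ _ ((xGood hD α γ).ty_steps h.xTy hs.steps.xSteps) h'.xTy

end Construction

/-! ### Inversion of reductions to `⊤` -/

section Inversion

variable {S : CanSys B D}

theorem OSteps.app_lam_inv {P : Tm S.C → Tm S.C → Prop} (hP : SubstStable S P) {q s u : Tm S.C}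
    (h : OSteps S P (.app (.lam q) s) u) :
    (∃ q' s', u = .app (.lam q') s' ∧ OSteps S P q q' ∧ OSteps S P s s') ∨
      OSteps S P (q.subst0 s) u := by
  induction h with
  | refl => exact .inl ⟨q, s, rfl, .refl, .refl⟩
  | tail _ h ih =>
    rcases ih with ⟨q', s', rfl, hq, hs⟩ | ih
    · rcases h.app_inv with ⟨_, e, rfl⟩ | ⟨_, _, _, hτ, hm, -⟩ | ⟨a', rfl, ha⟩ | ⟨s'', rfl, hs'⟩
      · cases e
        exact .inr (.subst0 hP hq hs)
      · obtain ⟨c, e⟩ := const_of_mem_arr hτ hm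
        cases e
      · rcases ha.lam_inv with rfl | ⟨q'', rfl, hq'⟩
        · have := OSteps.subst0 hP hq hs
          rw [Tm.subst0_eq (.app _ _), Tm.bind_app, ← Tm.subst0_eq, Tm.lift_subst0] at this
          exact .inr this
        · exact .inl ⟨q'', s', rfl, hq.tail hq', hs⟩
      · exact .inl ⟨q', s'', rfl, hq, hs.tail hs'⟩
    · exact .inr (ih.tail h)

theorem SuccS.top_inv {t : Tm S.C} (h : SuccS S t S.top) :
    t = S.top ∨ (∃ s, t = .app S.LT s) ∨ (∃ b s, t = .app (S.AT b) s) ∨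
      ∃ a s, t = .app (.app S.XiT a) s := by
  obtain ⟨α, h⟩ := h
  have h := h.xSucc
  rw [xSucc_eq] at h
  rcases h.prop_inv top_mem with e | ⟨s, e, -⟩ | ⟨b, s, e, -⟩ | ⟨a, s, -, e, -⟩
  · exact .inl e
  · exact .inr (.inl ⟨s, e⟩)
  · exact .inr (.inr (.inl ⟨b, s, e⟩))
  · exact .inr (.inr (.inr ⟨a, s, e⟩))

theorem LeadR.beta_top {q s : Tm S.C} (h : LeadR S (.app (.lam q) s) S.top) :
    LeadR S (q.subst0 s) S.top := by
  obtain ⟨u, h1, h2⟩ := leadR_iff.1 h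
  rcases h1.app_lam_inv SuccS.substStable with ⟨q', s', rfl, -⟩ | h1
  · rcases h2.top_inv with e | ⟨_, e⟩ | ⟨_, _, e⟩ | ⟨_, _, e⟩
    · exact absurd e.symm (canon_ne_app ⟨_, by simp, top_mem⟩)
    all_goals cases e
  · exact leadR_iff.2 ⟨u, h1, h2⟩

theorem LeadR.of_Ht_steps {t : Tm S.C} (h : LeadR S (S.Ht t) S.top) :
    ∃ α t', OSteps S (SuccS S) t t' ∧ Succ S α (S.Ht t') S.top := by
  obtain ⟨u, h1, α, h2⟩ := leadR_iff.1 h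
  obtain ⟨v, rfl, h3⟩ := h1.app_const_inv not_canon_L
  obtain ⟨t', rfl, h4⟩ := h3.K_inv SuccS.substStable
  exact ⟨α, t', h4, h2⟩

theorem Sim.nonempty (hD : ∀ b, Nonempty (D b)) {α : Ordinal.{0}} {t : Tm S.C} {τ : ETy B}
    (h : Sim S α t τ) (hτ : τ ≠ .eps) : (S.TT τ).Nonempty :=
  nonempty_of_isTp hD h.xTy.isTp hτ

theorem LeadR.xi_top {α : Ordinal.{0}} {a s : Tm S.C} {τ : ETy B} (ha : Sim S α a τ)
    (h : ∀ t ∈ S.TT τ, LeadR S (.app s t) S.top) :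
    LeadR S (.app (.app S.XiT a) s) S.top := by
  obtain ⟨β, hβ⟩ := exists_leadLt_forall (g := fun _ => S.top) h
  exact (Succ.xiTop ((zero_le (a := max α β)).trans_lt (Order.lt_succ _))
    (ha.mono ((le_max_left α β).trans (Order.le_succ _)))
    fun t ht => (hβ t ht).mono ((le_max_right α β).trans (Order.le_succ _))).leadR

theorem LeadR.xi_bot {α γ : Ordinal.{0}} {a s t : Tm S.C} {τ : ETy B} (ha : Sim S α a τ)
    (hH : Succ S γ (S.Ht (.app (.app S.XiT a) s)) S.top) (ht : t ∈ S.TT τ)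
    (h : LeadR S (.app s t) S.bot) : LeadR S (.app (.app S.XiT a) s) S.bot := by
  obtain ⟨β, hβ⟩ := h.exists_leadLt
  have hγ : γ < Order.succ (max γ (max α β)) := (le_max_left γ _).trans_lt (Order.lt_succ _)
  have hm : max α β ≤ Order.succ (max γ (max α β)) :=
    (le_max_right γ _).trans (Order.le_succ _)
  exact (Succ.xiBot (zero_le.trans_lt hγ) hγ hH (ha.mono ((le_max_left α β).trans hm)) ht
    (hβ.mono ((le_max_right α β).trans hm))).leadR

theorem Succ.Ht_inv (hD : ∀ b, Nonempty (D b)) {α : Ordinal.{0}} {t : Tm S.C}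
    (h : Succ S α (S.Ht t) S.top) : LeadR S t S.top ∨ LeadR S t S.bot := by
  induction α using WellFoundedLT.induction generalizing t with
  | _ α ih =>
  have ih' {t : Tm S.C} (h : LeadLt S α (S.Ht t) S.top) : LeadR S t S.top ∨ LeadR S t S.bot := by
    obtain ⟨γ, hγ, u, h1, h2⟩ := leadLt_iff.1 h
    obtain ⟨v, rfl, h3⟩ := h1.app_const_inv not_canon_L
    obtain ⟨t', rfl, h4⟩ := h3.K_inv fun _ _ ⟨δ, hδ, h⟩ σ => ⟨δ, hδ, (succ_sim_bind δ).1 _ _ h σ⟩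
    have h1 : OSteps S (SuccS S) t t' := h4.mono fun _ _ ⟨δ, _, h⟩ => ⟨δ, h⟩
    exact (ih γ hγ h2).imp (fun h => h.of_steps h1) fun h => h.of_steps h1
  have hH := h
  have ft {a b : Tm S.C} (e : S.Kt t = S.Ft a b) :
      ∃ r, t = .app (.app S.XiT a) (S.Kt r) ∧ b = S.Kt r := by
    rw [Ft_eq] at e
    obtain ⟨s, rfl, e'⟩ := CanSys.Kt_eq_xiLam e
    obtain ⟨r, hr, rfl⟩ := eq_Kt_of_lam_bind_fsub (S := S) e'
    exact ⟨r, rfl, Tm.eq_Kt_of_body hr⟩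
  generalize e : S.Ht t = u at h
  generalize e' : S.top = v at h
  cases h with
  | refl hτ hρ => exact absurd e.symm (canon_ne_app ⟨_, hτ, hρ⟩)
  | fn hρ h =>
    subst e'
    exact absurd (type_unique (by simp) (by simp) hρ top_mem) (by simp)
  | topLA _ b => cases e
  | topLH => exact absurd (Tm.app.inj e).2 (CanSys.Kt_ne_of_occ (.inr rfl))
  | topA hc => exact absurd (Tm.const.inj (Tm.app.inj e).1) (S.hLA _)
  | topH hc =>
    obtain rfl := CanSys.Kt_inj (Tm.app.inj e).2
    rcases hc with rfl | rfl
    · exact .inl (Succ.refl (by simp) top_mem 0).leadR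
    · exact .inr (Succ.refl (by simp) bot_mem 0).leadR
  | xiTop hα h1 h2 => cases e
  | @xiHTop _ _ a s τ h1 h2 =>
    obtain rfl := CanSys.Kt_inj (Tm.app.inj e).2
    by_cases h3 : ∀ t ∈ S.TT τ, LeadR S (.app s t) S.top
    · exact .inl (.xi_top h1 h3)
    · push Not at h3
      obtain ⟨t3, h3, h4⟩ := h3
      exact .inr (.xi_bot h1 hH h3 ((ih' (h2 t3 h3)).resolve_left h4))
  | flTopEps hα h1 =>
    obtain ⟨r, rfl, -⟩ := ft (Tm.app.inj e).2
    refine .inl (.xi_top h1 fun t ht => ?_)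
    rw [S.TT_eps] at ht
    exact ht.elim
  | flTop hα hτ h1 h2 =>
    obtain ⟨r, rfl, rfl⟩ := ft (Tm.app.inj e).2
    have hK (u : Tm S.C) : OSteps S (SuccS S) (.app (S.Kt r) u) r := by
      have := OStep.beta (P := SuccS S) r.lift u
      rw [Tm.lift_subst0] at this
      exact .single this
    rcases ih' h2 with hr | hr
    · exact .inl (.xi_top h1 fun u _ => hr.of_steps (hK u))
    · obtain ⟨u, hu⟩ := h1.nonempty hD hτ
      exact .inr (.xi_bot h1 hH hu (hr.of_steps (hK u)))
  | hiTop hα h =>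
    obtain rfl := CanSys.Kt_inj (Tm.app.inj e).2
    exact .inl h.leadR
  | xiBot => exact absurd e' S.top_ne_bot

theorem LeadR.Ht_inv (hD : ∀ b, Nonempty (D b)) {t : Tm S.C} (h : LeadR S (S.Ht t) S.top) :
    LeadR S t S.top ∨ LeadR S t S.bot := by
  obtain ⟨α, t', h1, h2⟩ := h.of_Ht_steps
  exact (h2.Ht_inv hD).imp (fun h => h.of_steps h1) fun h => h.of_steps h1

theorem LeadR.xi_inv (hD : ∀ b, Nonempty (D b)) {α : Ordinal.{0}} {a s : Tm S.C} {τ : ETy B}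
    (ha : Sim S α a τ) (h : LeadR S (.app (.app S.XiT a) s) S.top) :
    ∀ t ∈ S.TT τ, LeadR S (.app s t) S.top := by
  obtain ⟨u, h1, β, h2⟩ := leadR_iff.1 h
  obtain ⟨a', s', rfl, h3, hs⟩ := h1.app_app_const_inv not_canon_Xi
  generalize e : Tm.app (.app (.const S.cXi) a') s' = u at h2
  generalize e' : S.top = v at h2
  cases h2 with
  | refl hτ hρ => exact absurd e.symm (canon_ne_app ⟨_, hτ, hρ⟩)
  | fn hρ h =>
    subst e'
    exact absurd (type_unique (by simp) (by simp) hρ top_mem) (by simp)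
  | xiTop hα h4 h5 =>
    cases e
    obtain rfl := ha.type_unique_of_steps hD h3 h4
    exact fun t ht => (h5 t ht).leadR.of_steps (OSteps.appL t hs)
  | xiBot => exact absurd e' S.top_ne_bot
  | _ => cases e

theorem LeadR.Ft_inv (hD : ∀ b, Nonempty (D b)) {α : Ordinal.{0}} {a b s : Tm S.C} {τ : ETy B}
    (ha : Sim S α a τ) (h : LeadR S (.app (S.Ft a b) s) S.top) :
    ∀ t ∈ S.TT τ, LeadR S (.app b (.app s t)) S.top := by
  intro t ht
  rw [Ft_eq] at h
  have h1 := h.beta_top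
  rw [Tm.subst0_eq, Tm.bind_app, Tm.bind_app, ← Tm.subst0_eq a.lift, Tm.lift_subst0] at h1
  have h2 := LeadR.beta_top (LeadR.xi_inv hD ha h1 t ht)
  refine LeadR.of_steps ?_ (Tm.app_body _ b (.app s t))
  rw [Tm.bind_bind, Tm.subst0_eq, Tm.bind_bind] at h2
  rw [Tm.subst0_eq]
  convert h2 using 3 with n
  cases n with
  | zero => exact congrArg (Tm.app · t) (Tm.lift_subst0 s t).symm
  | succ n => rfl

/-- A term whose values on `T_{τ₁}` are canonical of type `τ₂` has a canonical value. -/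
theorem LeadR.exists_arr {τ1 τ2 : ETy B} (hτ : IsT1 (.arr τ1 τ2)) {t : Tm S.C}
    (h : ∀ t1 ∈ S.TT τ1, ∃ ρ ∈ S.TT τ2, LeadR S (.app t t1) ρ) :
    ∃ ρ ∈ S.TT (.arr τ1 τ2), LeadR S t ρ := by
  suffices ∃ ρ ∈ S.TT (.arr τ1 τ2), ∀ t1 ∈ S.TT τ1, LeadR S (.app t t1) (S.F τ1 τ2 ρ t1) by
    obtain ⟨ρ, hρ, h⟩ := this
    obtain ⟨α, h⟩ := exists_leadLt_forall h
    exact ⟨ρ, hρ, (Succ.fn hρ h).leadR⟩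
  by_cases hω : τ1 = .omega
  · subst hω
    obtain ⟨n, hn⟩ := Tm.exists_fresh_bind t
    obtain ⟨ρ, hρ, h1⟩ := h (.var n) (by rw [S.TT_omega]; trivial)
    refine ⟨.lam ρ, by rw [S.TT_omega_arr τ2 hτ.arr_right]; exact ⟨ρ, hρ, rfl⟩, fun s _ => ?_⟩
    obtain ⟨σ, e1, e2⟩ := hn s .var
    have h2 := h1.bind σ
    rwa [Tm.bind_app, e1, Tm.bind_var, Tm.bind_var_apply, e2, ← S.F_omega τ2 ρ hρ s] at h2
  · choose! g hg hl using h
    obtain ⟨ρ, hρ, he⟩ := S.F_full τ1 τ2 hτ hω g hg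
    exact ⟨ρ, hρ, fun t1 h1 => he t1 h1 ▸ hl t1 h1⟩

end Inversion

/-- **Lemma 4.21.**  If `t₁ ∼_α τ` with `τ ≠ ω`, `τ ≠ ε`, and `t₁ t₂ ⇝ ⊤`, then
`t₂ ⇝ ρ` for some canonical term `ρ ∈ T_τ`. -/
theorem succ_type_lemma {B : Type} [Finite B] {D : B → Type} (hD : ∀ b, Nonempty (D b))
    (S : CanSys B D) (α : Ordinal.{0}) (t1 : Tm S.C) (τ : ETy B)
    (h1 : Sim S α t1 τ) (hω : τ ≠ .omega) (hε : τ ≠ .eps)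
    (t2 : Tm S.C) (h2 : LeadR S (.app t1 t2) S.top) :
    ∃ ρ ∈ S.TT τ, LeadR S t2 ρ := by
  induction α using WellFoundedLT.induction generalizing t1 τ t2 with
  | _ α ih =>
  cases h1 with
  | ofA _ b =>
    obtain ⟨u, h3, α, h4⟩ := leadR_iff.1 h2
    obtain ⟨t', rfl, h5⟩ := h3.app_const_inv (not_canon_A b)
    generalize e : Tm.app (.const (S.cA b)) t' = u at h4
    generalize e' : S.top = v at h4
    cases h4 with
    | refl hτ hρ => exact absurd e.symm (canon_ne_app ⟨_, hτ, hρ⟩)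
    | fn hρ h =>
      subst e'
      exact absurd (type_unique (by simp) (by simp) hρ top_mem) (by simp)
    | topA hc =>
      simp only [CanSys.AT, Tm.app.injEq, Tm.const.injEq] at e
      obtain ⟨e, rfl⟩ := e
      obtain rfl := S.hAinj e
      exact ⟨t', hc, (Succ.refl (by simp) hc 0).leadR.of_steps h5⟩
    | xiBot => exact absurd e' S.top_ne_bot
    | topLA | topLH | topH | xiHTop | flTopEps | flTop | hiTop =>
      exact absurd (Tm.const.inj (Tm.app.inj e).1).symm (S.hLA b)
    | xiTop => cases e
  | ofH =>
    rcases LeadR.Ht_inv hD h2.beta_top with h | h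
    · exact ⟨S.top, top_mem, h⟩
    · exact ⟨S.bot, bot_mem, h⟩
  | ofKom | ofFom => exact absurd rfl hω
  | ofKeps => exact absurd rfl hε
  | @ofF _ γ1 γ2 hγ1 hγ2 a b τ1 τ2 ha hb =>
    rcases arrN_cases τ1 τ2 with e | e | ⟨e, h3, h4, h5⟩
    · exact absurd e hω
    · exact absurd e hε
    · have hT : IsT1 (arrN τ1 τ2) := by
        rcases ha.xTy.isTp.arrN hb.xTy.isTp with h | h | h
        · exact h
        · exact absurd h hω
        · exact absurd h hε
      rw [e] at hT ⊢
      exact LeadR.exists_arr hT fun t3 ht =>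
        ih γ2 hγ2 b τ2 hb h4 h5 (.app t2 t3) (LeadR.Ft_inv hD ha h2 t3 ht)

end ILM
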